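/- arXiv:0805.3602 — 6 statements merged into one kernel-verified Lean document; each statement's English description precedes it below -/
import Mathlib

section
/- For every natural number t and every vector b = (b_0, b_1, …, b_t) of natural numbers, the integral of the monomial θ_0^{b_0} θ_1^{b_1} ⋯ θ_t^{b_t} over the standard probability simplex Δ_t with respect to the Lebesgue probability measure equals t! · b_0! · b_1! ⋯ b_t! / (b_0 + b_1 + ⋯ + b_t + t)!. -/
open MeasureTheory

/-- The Lebesgue probability measure on the standard probability simplex
`Δ_t = {θ ∈ ℝ_{≥0}^{t+1} : θ_0 + ⋯ + θ_t = 1}`, realized as the pushforward of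
`t!` times Lebesgue measure on `{θ ∈ ℝ_{≥0}^t : θ_1 + ⋯ + θ_t ≤ 1}` under
`θ ↦ (1 - θ_1 - ⋯ - θ_t, θ_1, …, θ_t)`. -/
noncomputable def simplexMeasure (t : ℕ) : Measure (Fin (t + 1) → ℝ) :=
  Measure.map (fun θ : Fin t → ℝ => Fin.cons (1 - ∑ i, θ i) θ)
    ((t.factorial : ENNReal) •
      volume.restrict {θ : Fin t → ℝ | (∀ i, 0 ≤ θ i) ∧ ∑ i, θ i ≤ 1})

open scoped Nat in
/-- The Beta integral with natural exponents over an interval `[0, s]`. -/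
theorem integral_pow_mul_sub_pow (s : ℝ) (n m : ℕ) :
    ∫ x in (0 : ℝ)..s, x ^ n * (s - x) ^ m = n ! * m ! / (n + m + 1)! * s ^ (n + m + 1) := by
  induction n generalizing m with
  | zero =>
    have h := intervalIntegral.integral_comp_sub_left (a := 0) (b := s) (fun x : ℝ => x ^ m) s
    simp only [pow_zero, one_mul, h, sub_self, sub_zero, integral_pow, zero_add,
      Nat.factorial_succ]
    have := Nat.factorial_ne_zero m
    push_cast
    field_simp
    simp
  | succ n ih =>
    have hderiv : ∀ x ∈ Set.uIcc 0 s, HasDerivAt (fun x : ℝ => x ^ (n + 1) * (s - x) ^ (m + 1))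
        ((n + 1) * (x ^ n * (s - x) ^ (m + 1)) - (m + 1) * (x ^ (n + 1) * (s - x) ^ m)) x := by
      intro x _
      refine ((hasDerivAt_pow (n + 1) x).fun_mul
        (((hasDerivAt_id' x).const_sub s).fun_pow (m + 1))).congr_deriv ?_
      push_cast [Nat.add_sub_cancel]
      ring
    have h := intervalIntegral.integral_eq_sub_of_hasDerivAt hderiv
      (Continuous.intervalIntegrable (by fun_prop) _ _)
    rw [intervalIntegral.integral_sub (Continuous.intervalIntegrable (by fun_prop) _ _)
      (Continuous.intervalIntegrable (by fun_prop) _ _),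
      intervalIntegral.integral_const_mul, intervalIntegral.integral_const_mul, ih] at h
    have hm : (m + 1 : ℝ) ≠ 0 := by positivity
    apply mul_left_cancel₀ hm
    rw [show n + 1 + m + 1 = n + (m + 1) + 1 by ring, Nat.factorial_succ n]
    rw [Nat.factorial_succ m] at h
    push_cast at h ⊢
    simp only [ne_eq, Nat.add_eq_zero_iff, one_ne_zero, and_false, not_false_eq_true, zero_pow,
      sub_self, mul_zero, zero_mul] at h
    linear_combination -h

theorem isCompact_setOf_nonneg_sum_le (t : ℕ) (s : ℝ) :
    IsCompact {θ : Fin t → ℝ | (∀ i, 0 ≤ θ i) ∧ ∑ i, θ i ≤ s} := by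
  refine (isCompact_Icc (a := (0 : Fin t → ℝ)) (b := fun _ => s)).of_isClosed_subset ?_ ?_
  · refine IsClosed.and ?_ (isClosed_le (by fun_prop) (by fun_prop))
    simp only [Set.ofPred_forall]
    exact isClosed_iInter fun i => isClosed_le (by fun_prop) (by fun_prop)
  · rintro θ ⟨h0, hs⟩
    exact ⟨h0, fun i => (Finset.single_le_sum (fun j _ => h0 j) (Finset.mem_univ i)).trans hs⟩

/-- Integration over the simplex `{θ ≥ 0, ∑ θ ≤ s}` by slicing along the first coordinate. -/
theorem setIntegral_nonneg_sum_le_succ (t : ℕ) {s : ℝ} (hs : 0 ≤ s)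
    {f : (Fin (t + 1) → ℝ) → ℝ} (hf : Continuous f) :
    ∫ θ in {θ : Fin (t + 1) → ℝ | (∀ i, 0 ≤ θ i) ∧ ∑ i, θ i ≤ s}, f θ =
      ∫ x in (0 : ℝ)..s,
        ∫ θ in {θ : Fin t → ℝ | (∀ i, 0 ≤ θ i) ∧ ∑ i, θ i ≤ s - x}, f (Fin.cons x θ) := by
  have hS := isCompact_setOf_nonneg_sum_le (t + 1) s
  set S := {θ : Fin (t + 1) → ℝ | (∀ i, 0 ≤ θ i) ∧ ∑ i, θ i ≤ s} with hS_def
  let e := (MeasurableEquiv.piFinSuccAbove (fun _ : Fin (t + 1) => ℝ) 0).symm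
  have he : MeasurePreserving e := (volume_preserving_piFinSuccAbove (fun _ => ℝ) 0).symm
  have he_apply : ∀ p : ℝ × (Fin t → ℝ), e p = Fin.cons p.1 p.2 := fun p => by
    simp [e, MeasurableEquiv.piFinSuccAbove_symm_apply, Fin.insertNthEquiv]
  have hint : Integrable (S.indicator f) :=
    (hf.continuousOn.integrableOn_compact hS).integrable_indicator hS.measurableSet
  rw [← integral_indicator hS.measurableSet, ← he.integral_comp' (S.indicator f),
    Measure.volume_eq_prod, integral_prod _
      (by rw [← Measure.volume_eq_prod]; exact (he.integrable_comp_emb e.measurableEmbedding).2 hint),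
    intervalIntegral.integral_of_le hs, ← integral_Icc_eq_integral_Ioc,
    ← integral_indicator measurableSet_Icc]
  congr 1 with x
  have hmem : ∀ θ : Fin t → ℝ, (Fin.cons x θ : Fin (t + 1) → ℝ) ∈ S ↔
      0 ≤ x ∧ (∀ i, 0 ≤ θ i) ∧ ∑ i, θ i ≤ s - x := fun θ => by
    simp [hS_def, Fin.forall_fin_succ, Fin.sum_univ_succ, and_assoc, le_sub_iff_add_le']
  by_cases hx : x ∈ Set.Icc 0 s
  · rw [Set.indicator_of_mem hx,
      ← integral_indicator (isCompact_setOf_nonneg_sum_le t (s - x)).measurableSet]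
    congr 1 with θ
    simp only [he_apply, Set.indicator, hmem, hx.1, true_and, Set.mem_ofPred_eq]
  · rw [Set.indicator_of_notMem hx]
    refine integral_eq_zero_of_ae (.of_forall fun θ => ?_)
    simp only [he_apply]
    refine Set.indicator_of_notMem (fun h => hx ?_) _
    obtain ⟨h0, hθ, hsum⟩ := (hmem θ).1 h
    exact ⟨h0, by linarith [Finset.sum_nonneg fun i (_ : i ∈ Finset.univ) => hθ i]⟩

open scoped Nat in
/-- The Dirichlet integral with natural exponents over the simplex `{θ ≥ 0, ∑ θ ≤ s}`. -/
theorem setIntegral_sub_sum_pow_mul_prod_pow (t a : ℕ) (c : Fin t → ℕ) {s : ℝ} (hs : 0 ≤ s) :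
    ∫ θ in {θ : Fin t → ℝ | (∀ i, 0 ≤ θ i) ∧ ∑ i, θ i ≤ s}, (s - ∑ i, θ i) ^ a * ∏ i, θ i ^ c i =
      a ! * (∏ i, ((c i)! : ℝ)) / (a + ∑ i, c i + t)! * s ^ (a + ∑ i, c i + t) := by
  induction t generalizing s with
  | zero =>
    have := Nat.factorial_ne_zero a
    simp [hs, integral_unique, measureReal_def, this, volume_pi]
  | succ t ih =>
    rw [setIntegral_nonneg_sum_le_succ t hs (by fun_prop)]
    have hslice : ∀ x ∈ Set.uIcc 0 s,
        ∫ θ in {θ : Fin t → ℝ | (∀ i, 0 ≤ θ i) ∧ ∑ i, θ i ≤ s - x},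
          (s - ∑ i, (Fin.cons x θ : Fin (t + 1) → ℝ) i) ^ a *
            ∏ i, (Fin.cons x θ : Fin (t + 1) → ℝ) i ^ c i =
        a ! * (∏ i : Fin t, ((c i.succ)! : ℝ)) / (a + ∑ i : Fin t, c i.succ + t)! *
          (x ^ c 0 * (s - x) ^ (a + ∑ i : Fin t, c i.succ + t)) := by
      intro x hx
      rw [Set.uIcc_of_le hs] at hx
      rw [mul_left_comm, ← ih (fun i => c i.succ) (sub_nonneg.2 hx.2), ← integral_const_mul]
      congr 1 with θ
      simp only [Fin.sum_univ_succ, Fin.prod_univ_succ, Fin.cons_zero, Fin.cons_succ]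
      ring
    rw [intervalIntegral.integral_congr hslice, intervalIntegral.integral_const_mul,
      integral_pow_mul_sub_pow, Fin.sum_univ_succ, Fin.prod_univ_succ,
      show c 0 + (a + ∑ i : Fin t, c i.succ + t) + 1 =
        a + (c 0 + ∑ i : Fin t, c i.succ) + (t + 1) by ring]
    have := Nat.factorial_ne_zero (a + ∑ i : Fin t, c i.succ + t)
    field_simp

/-- The integral of the monomial `θ_0^{b_0} ⋯ θ_t^{b_t}` over the standard probability
simplex `Δ_t` with respect to the Lebesgue probability measure equals
`t! · b_0! ⋯ b_t! / (b_0 + ⋯ + b_t + t)!`. -/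
theorem integral_monomial_simplex (t : ℕ) (b : Fin (t + 1) → ℕ) :
    ∫ θ : Fin (t + 1) → ℝ, (∏ i, θ i ^ b i) ∂(simplexMeasure t)
      = ((t.factorial : ℝ) * ∏ i, ((b i).factorial : ℝ)) /
          (((∑ i, b i) + t).factorial : ℝ) := by
  have hmeas : Measurable fun θ : Fin t → ℝ =>
      (Fin.cons (1 - ∑ i, θ i) θ : Fin (t + 1) → ℝ) := by
    refine measurable_pi_iff.2 fun i => ?_
    cases i using Fin.cases <;> simp only [Fin.cons_zero, Fin.cons_succ] <;> fun_prop
  rw [simplexMeasure, integral_map hmeas.aemeasurable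
    (Continuous.aestronglyMeasurable (by fun_prop)), integral_smul_measure]
  simp only [Fin.prod_univ_succ, Fin.sum_univ_succ, Fin.cons_zero, Fin.cons_succ]
  rw [setIntegral_sub_sum_pow_mul_prod_pow t (b 0) (fun i => b i.succ) zero_le_one]
  simp [mul_div_assoc]
end

section
/- For every data vector U ∈ ℕ^n, the marginal likelihood of U with respect to the mixture model M^(2), namely (N!/(U_1!⋯U_n!)) · ∫_Θ ∏_{v=1}^n (σ_0 θ^{a_v} + σ_1 ρ^{a_v})^{U_v} dσ dθ dρ where N = U_1 + ⋯ + U_n, is a rational number. -/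
open MeasureTheory

/-- The state space `∏_{i=1}^k {0,…,t_i}^{s_i}` of the independence model. -/
abbrev SVState (k : ℕ) (s t : Fin k → ℕ) := ∀ i : Fin k, Fin (s i) → Fin (t i + 1)

/-- The entry of the Segre–Veronese matrix `A` in row `(i,j)` and column `v`,
namely `#{l ∈ {1,…,s_i} : v^{(i)}_l = j}`. -/
def SVcol (k : ℕ) (s t : Fin k → ℕ) (v : SVState k s t) (i : Fin k) (j : Fin (t i + 1)) : ℕ :=
  (Finset.univ.filter fun l : Fin (s i) => v i l = j).card

/-- The product Lebesgue probability measure on `Θ = Δ_1 × P × P`. -/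
noncomputable def thetaMeasure (k : ℕ) (t : Fin k → ℕ) :
    Measure ((Fin 2 → ℝ) ×
      ((∀ i : Fin k, Fin (t i + 1) → ℝ) × (∀ i : Fin k, Fin (t i + 1) → ℝ))) :=
  (simplexMeasure 1).prod
    ((Measure.pi fun i => simplexMeasure (t i)).prod (Measure.pi fun i => simplexMeasure (t i)))

/-- The solid simplex of size `r` in the positive orthant. -/
def solidSimplex (t : ℕ) (r : ℝ) : Set (Fin t → ℝ) := {θ | (∀ i, 0 ≤ θ i) ∧ ∑ i, θ i ≤ r}

theorem isCompact_solidSimplex (t : ℕ) (r : ℝ) : IsCompact (solidSimplex t r) := by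
  refine (isCompact_Icc (a := (0 : Fin t → ℝ)) (b := fun _ => r)).of_isClosed_subset ?_ ?_
  · refine IsClosed.inter (s₁ := {θ : Fin t → ℝ | ∀ i, 0 ≤ θ i})
      (s₂ := {θ : Fin t → ℝ | ∑ i, θ i ≤ r}) ?_ (isClosed_le (by fun_prop) continuous_const)
    simp only [Set.ofPred_forall]
    exact isClosed_iInter fun i => isClosed_le continuous_const (continuous_apply i)
  · rintro θ ⟨h0, h1⟩
    exact ⟨h0, fun i => (Finset.single_le_sum (fun j _ => h0 j) (Finset.mem_univ i)).trans h1⟩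

theorem cons_mem_solidSimplex_iff {t : ℕ} {r x : ℝ} {y : Fin t → ℝ} :
    (Fin.cons x y : Fin (t + 1) → ℝ) ∈ solidSimplex (t + 1) r ↔
      x ∈ Set.Icc 0 r ∧ y ∈ solidSimplex t (r - x) := by
  simp only [solidSimplex, Set.mem_ofPred_eq, Fin.forall_fin_succ, Fin.cons_zero, Fin.cons_succ,
    Fin.sum_univ_succ, Set.mem_Icc]
  constructor
  · rintro ⟨⟨hx, hy⟩, h⟩
    have := Finset.sum_nonneg fun i (_ : i ∈ Finset.univ) => hy i
    exact ⟨⟨hx, by linarith⟩, hy, by linarith⟩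
  · rintro ⟨⟨hx, -⟩, hy, h⟩
    exact ⟨⟨hx, hy⟩, by linarith⟩

theorem setIntegral_solidSimplex_succ {t : ℕ} {r : ℝ} {f : (Fin (t + 1) → ℝ) → ℝ}
    (hf : Continuous f) :
    ∫ θ in solidSimplex (t + 1) r, f θ =
      ∫ x in Set.Icc 0 r, ∫ y in solidSimplex t (r - x), f (Fin.cons x y) := by
  have hS := isCompact_solidSimplex (t + 1) r
  have hmp := (volume_preserving_piFinSuccAbove (fun _ : Fin (t + 1) => ℝ) 0).symm
  have hint : Integrable ((solidSimplex (t + 1) r).indicator f) :=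
    (integrable_indicator_iff hS.measurableSet).2 (hf.continuousOn.integrableOn_compact hS)
  have hsymm : ∀ p : ℝ × (Fin t → ℝ),
      (MeasurableEquiv.piFinSuccAbove (fun _ : Fin (t + 1) => ℝ) 0).symm p
        = (Fin.cons p.1 p.2 : Fin (t + 1) → ℝ) := fun p => by
    simp [MeasurableEquiv.piFinSuccAbove, Fin.insertNthEquiv]
  rw [← integral_indicator hS.measurableSet, ← hmp.integral_comp', Measure.volume_eq_prod,
    integral_prod (fun p => (solidSimplex (t + 1) r).indicator f
      ((MeasurableEquiv.piFinSuccAbove (fun _ : Fin (t + 1) => ℝ) 0).symm p))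
      ((hmp.integrable_comp_emb (MeasurableEquiv.measurableEmbedding _)).2 hint),
    ← integral_indicator measurableSet_Icc]
  congr 1 with x
  simp only [hsymm]
  by_cases hx : x ∈ Set.Icc 0 r
  · rw [Set.indicator_of_mem hx,
      ← integral_indicator (isCompact_solidSimplex t (r - x)).measurableSet]
    congr 1 with y
    by_cases hy : y ∈ solidSimplex t (r - x) <;>
      simp [cons_mem_solidSimplex_iff, hx, hy]
  · simp [cons_mem_solidSimplex_iff, hx]

theorem integral_pow_mul_sub_pow_s4 (m e : ℕ) :
    ∃ c : ℚ, ∀ r : ℝ, ∫ x in (0 : ℝ)..r, x ^ m * (r - x) ^ e = c * r ^ (m + e + 1) := by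
  refine ⟨∑ j ∈ Finset.range (e + 1), (-1) ^ j * (e.choose j) / (m + j + 1), fun r => ?_⟩
  have h : ∀ x : ℝ, x ^ m * (r - x) ^ e =
      ∑ j ∈ Finset.range (e + 1), ((-1) ^ j * r ^ (e - j) * e.choose j) * x ^ (m + j) := by
    intro x
    rw [sub_eq_neg_add, add_pow, Finset.mul_sum]
    refine Finset.sum_congr rfl fun j _ => ?_
    rw [neg_pow, pow_add]
    ring
  simp only [h]
  rw [intervalIntegral.integral_finsetSum
    fun j _ => Continuous.intervalIntegrable (by fun_prop) _ _]
  push_cast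
  rw [Finset.sum_mul]
  refine Finset.sum_congr rfl fun j hj => ?_
  have hj : e - j + (m + j + 1) = m + e + 1 := by
    have := Finset.mem_range.1 hj
    omega
  rw [intervalIntegral.integral_const_mul, integral_pow, ← hj, pow_add]
  simp
  ring

/-- Dirichlet integrals with natural exponents, up to a rational constant. -/
theorem setIntegral_solidSimplex_monomial (t : ℕ) (m : Fin t → ℕ) (b : ℕ) :
    ∃ (c : ℚ) (e : ℕ), ∀ r : ℝ, 0 ≤ r →
      ∫ θ in solidSimplex t r, (r - ∑ i, θ i) ^ b * ∏ i, θ i ^ m i = c * r ^ e := by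
  induction t with
  | zero =>
    refine ⟨1, b, fun r hr => ?_⟩
    have h : solidSimplex 0 r = Set.univ := by
      ext θ
      simpa [solidSimplex] using hr
    simp [h, integral_unique, measureReal_def, volume_pi]
  | succ t ih =>
    obtain ⟨c, e, hc⟩ := ih fun i => m i.succ
    obtain ⟨c', hc'⟩ := integral_pow_mul_sub_pow_s4 (m 0) e
    refine ⟨c * c', m 0 + e + 1, fun r hr => ?_⟩
    rw [setIntegral_solidSimplex_succ (by fun_prop)]
    have h : ∀ x ∈ Set.Icc 0 r, ∫ y in solidSimplex t (r - x),
        (r - ∑ i, (Fin.cons x y : Fin (t + 1) → ℝ) i) ^ b *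
          ∏ i, (Fin.cons x y : Fin (t + 1) → ℝ) i ^ m i = c * (x ^ m 0 * (r - x) ^ e) := by
      intro x hx
      rw [mul_left_comm, ← hc (r - x) (sub_nonneg.2 hx.2), ← integral_const_mul]
      congr 1 with y
      simp only [Fin.sum_univ_succ, Fin.prod_univ_succ, Fin.cons_zero, Fin.cons_succ]
      ring
    rw [setIntegral_congr_fun measurableSet_Icc h, integral_Icc_eq_integral_Ioc,
      ← intervalIntegral.integral_of_le hr, intervalIntegral.integral_const_mul, hc']
    push_cast
    ring

/-- The function `f` is integrable with respect to `μ`, and its integral is a rational number. -/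
def HasRationalIntegral {Ω : Type*} [MeasurableSpace Ω] (μ : Measure Ω) (f : Ω → ℝ) : Prop :=
  Integrable f μ ∧ ∃ q : ℚ, ∫ ω, f ω ∂μ = q

namespace HasRationalIntegral

theorem add {Ω : Type*} [MeasurableSpace Ω] {μ : Measure Ω} {f g : Ω → ℝ}
    (hf : HasRationalIntegral μ f) (hg : HasRationalIntegral μ g) :
    HasRationalIntegral μ fun ω => f ω + g ω := by
  obtain ⟨hf, p, hp⟩ := hf
  obtain ⟨hg, q, hq⟩ := hg
  exact ⟨hf.add hg, p + q, by rw [integral_add hf hg, hp, hq, Rat.cast_add]⟩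

theorem const_mul {Ω : Type*} [MeasurableSpace Ω] {μ : Measure Ω} {f : Ω → ℝ}
    (hf : HasRationalIntegral μ f) (c : ℚ) : HasRationalIntegral μ fun ω => (c : ℝ) * f ω := by
  obtain ⟨hf, p, hp⟩ := hf
  exact ⟨hf.const_mul _, c * p, by rw [integral_const_mul, hp, Rat.cast_mul]⟩

theorem mul_prod {Ω Ω' : Type*} [MeasurableSpace Ω] [MeasurableSpace Ω'] {μ : Measure Ω}
    {ν : Measure Ω'} [SFinite μ] [SFinite ν] {f : Ω → ℝ} {g : Ω' → ℝ}
    (hf : HasRationalIntegral μ f) (hg : HasRationalIntegral ν g) :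
    HasRationalIntegral (μ.prod ν) fun z => f z.1 * g z.2 := by
  obtain ⟨hf, p, hp⟩ := hf
  obtain ⟨hg, q, hq⟩ := hg
  exact ⟨hf.mul_prod hg, p * q, by rw [integral_prod_mul, hp, hq, Rat.cast_mul]⟩

theorem fintype_prod {ι : Type*} [Fintype ι] {Ω : ι → Type*} [∀ i, MeasurableSpace (Ω i)]
    {μ : ∀ i, Measure (Ω i)} [∀ i, SigmaFinite (μ i)] {f : ∀ i, Ω i → ℝ}
    (hf : ∀ i, HasRationalIntegral (μ i) (f i)) :
    HasRationalIntegral (Measure.pi μ) fun x => ∏ i, f i (x i) := by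
  choose hf q hq using hf
  refine ⟨Integrable.fintype_prod_dep hf, ∏ i, q i, ?_⟩
  rw [integral_fintype_prod_eq_prod]
  simp [hq]

theorem aeval {Ω ι : Type*} [MeasurableSpace Ω] [Fintype ι] {μ : Measure Ω} {X : Ω → ι → ℝ}
    (hX : ∀ m : ι → ℕ, HasRationalIntegral μ fun ω => ∏ i, X ω i ^ m i) (p : MvPolynomial ι ℚ) :
    HasRationalIntegral μ fun ω => MvPolynomial.aeval (X ω) p := by
  induction p using MvPolynomial.induction_on' with
  | monomial u a =>
    simp only [MvPolynomial.aeval_monomial, eq_ratCast]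
    convert (hX u).const_mul a using 4
    exact Finsupp.prod_fintype _ _ fun i => pow_zero _
  | add p q hp hq => simpa only [map_add] using hp.add hq

end HasRationalIntegral

theorem hasRationalIntegral_simplexMeasure (t : ℕ) (m : Fin (t + 1) → ℕ) :
    HasRationalIntegral (simplexMeasure t) fun θ => ∏ j, θ j ^ m j := by
  have hcont : Continuous fun θ : Fin t → ℝ => (Fin.cons (1 - ∑ i, θ i) θ : Fin (t + 1) → ℝ) :=
    Continuous.finCons (by fun_prop) continuous_id
  have hmono : Continuous fun θ : Fin (t + 1) → ℝ => ∏ j, θ j ^ m j := by fun_prop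
  constructor
  · refine (integrable_map_measure hmono.aestronglyMeasurable hcont.aemeasurable).2 ?_
    refine Integrable.smul_measure ?_ (ENNReal.natCast_ne_top _)
    exact (hmono.comp hcont).continuousOn.integrableOn_compact (isCompact_solidSimplex t 1)
  · obtain ⟨c, e, h⟩ := setIntegral_solidSimplex_monomial t (fun i => m i.succ) (m 0)
    refine ⟨t.factorial * c, ?_⟩
    have h1 := h 1 zero_le_one
    rw [one_pow, mul_one] at h1
    rw [simplexMeasure, integral_map hcont.aemeasurable hmono.aestronglyMeasurable,
      integral_smul_measure]
    simp only [Fin.prod_univ_succ, Fin.cons_zero, Fin.cons_succ]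
    push_cast
    rw [← h1]
    simp [solidSimplex]

instance (t : ℕ) : IsFiniteMeasure (simplexMeasure t) := by
  have h := (hasRationalIntegral_simplexMeasure t 0).1
  simpa [integrable_const_iff] using h

theorem hasRationalIntegral_thetaMeasure (k : ℕ) (t : Fin k → ℕ)
    (m : Fin 2 ⊕ ((Σ i : Fin k, Fin (t i + 1)) ⊕ (Σ i : Fin k, Fin (t i + 1))) → ℕ) :
    HasRationalIntegral (thetaMeasure k t) fun p =>
      ∏ x, (Sum.elim p.1 (Sum.elim (fun y => p.2.1 y.1 y.2) fun y => p.2.2 y.1 y.2) x) ^ m x := by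
  simp only [Fintype.prod_sum_type, Fintype.prod_sigma, Sum.elim_inl, Sum.elim_inr]
  have hP (a : (Σ i : Fin k, Fin (t i + 1)) → ℕ) :=
    HasRationalIntegral.fintype_prod fun i =>
      hasRationalIntegral_simplexMeasure (t i) fun j => a ⟨i, j⟩
  exact (hasRationalIntegral_simplexMeasure 1 fun j => m (.inl j)).mul_prod
    ((hP fun y => m (.inr (.inl y))).mul_prod (hP fun y => m (.inr (.inr y))))

/-- The marginal likelihood
`(N!/(U_1!⋯U_n!)) · ∫_Θ ∏_v (σ_0 θ^{a_v} + σ_1 ρ^{a_v})^{U_v} dσ dθ dρ`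
of a data vector `U` with respect to the mixture model `M^(2)` is a rational number. -/
theorem marginal_likelihood_mixture_rational (k : ℕ) (s t : Fin k → ℕ)
    (hk : 0 < k) (hs : ∀ i, 0 < s i) (ht : ∀ i, 0 < t i)
    (U : SVState k s t → ℕ) (N : ℕ) (hN : N = ∑ v, U v) :
    ∃ q : ℚ,
      ((N.factorial : ℝ) / ∏ v, ((U v).factorial : ℝ)) *
        (∫ p : (Fin 2 → ℝ) ×
            ((∀ i : Fin k, Fin (t i + 1) → ℝ) × (∀ i : Fin k, Fin (t i + 1) → ℝ)),
          ∏ v, (p.1 0 * (∏ i, ∏ j, p.2.1 i j ^ SVcol k s t v i j) +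
                p.1 1 * (∏ i, ∏ j, p.2.2 i j ^ SVcol k s t v i j)) ^ U v
          ∂(thetaMeasure k t))
      = (q : ℝ) := by
  obtain ⟨-, q, hq⟩ := HasRationalIntegral.aeval (hasRationalIntegral_thetaMeasure k t)
    (∏ v, (.X (.inl 0) * (∏ i, ∏ j, .X (.inr (.inl ⟨i, j⟩)) ^ SVcol k s t v i j) +
      .X (.inl 1) * (∏ i, ∏ j, .X (.inr (.inr ⟨i, j⟩)) ^ SVcol k s t v i j)) ^ U v)
  simp only [map_prod, map_pow, map_add, map_mul, MvPolynomial.aeval_X, Sum.elim_inl,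
    Sum.elim_inr] at hq
  exact ⟨N.factorial / (∏ v, ((U v).factorial : ℚ)) * q, by rw [hq]; push_cast; rfl⟩
end

section
/- Let U ∈ ℕ^n with N = U_1 + ⋯ + U_n. Then ∫_Θ ∏_{v=1}^n (σ_0 θ^{a_v} + σ_1 ρ^{a_v})^{U_v} dσ dθ dρ = Σ_{b ∈ Z_A^𝕃(U)} φ_A(b,U) · ( (|b|/a)! · (|c|/a)! / (N+1)! ) · ∏_{i=1}^k [ ( t_i! · b^{(i)}_0! ⋯ b^{(i)}_{t_i}! / (|b^{(i)}| + t_i)! ) · ( t_i! · c^{(i)}_0! ⋯ c^{(i)}_{t_i}! / (|c^{(i)}| + t_i)! ) ], where for each b in the sum, c = A·U − b. Consequently, the marginal likelihood of the data U in the mixture model M^(2) equals this sum times the normalizing constant N!/(U_1!⋯U_n!). -/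
open MeasureTheory

/-- `φ_A(b,U) = Σ_{0 ≤ x ≤ U, A·x = b} ∏_v C(U_v, x_v)`. -/
def phiSV (k : ℕ) (s t : Fin k → ℕ) (U : SVState k s t → ℕ)
    (b : ∀ i : Fin k, Fin (t i + 1) → ℤ) : ℕ :=
  ∑ x : ∀ v : SVState k s t, Fin (U v + 1),
    if ∀ i j, ((∑ v, (x v : ℕ) * SVcol k s t v i j : ℕ) : ℤ) = b i j then
      ∏ v, (U v).choose (x v : ℕ)
    else 0

/-- `Z_A^𝕃(U)`: lattice points of `𝕃 = A·ℤ^n` in the zonotope `Z_A(U)`. -/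
def ZAL (k : ℕ) (s t : Fin k → ℕ) (U : SVState k s t → ℕ) :
    Set (∀ i : Fin k, Fin (t i + 1) → ℤ) :=
  {b | (∃ z : SVState k s t → ℤ, ∀ i j, b i j = ∑ v, z v * (SVcol k s t v i j : ℤ)) ∧
       (∃ x : SVState k s t → ℝ, (∀ v, 0 ≤ x v ∧ x v ≤ (U v : ℝ)) ∧
          ∀ i j, (b i j : ℝ) = ∑ v, x v * (SVcol k s t v i j : ℝ))}

/-- `c = A·U - b`. -/
def SVcompl (k : ℕ) (s t : Fin k → ℕ) (U : SVState k s t → ℕ)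
    (b : ∀ i : Fin k, Fin (t i + 1) → ℤ) (i : Fin k) (j : Fin (t i + 1)) : ℤ :=
  ((∑ v, U v * SVcol k s t v i j : ℕ) : ℤ) - b i j

theorem integral_pow_mul_sub_pow_s6 (r : ℝ) (a b : ℕ) :
    ∫ x in (0 : ℝ)..r, x ^ a * (r - x) ^ b =
      r ^ (a + b + 1) * ((a.factorial * b.factorial : ℝ) / ((a + b + 1).factorial : ℝ)) := by
  induction b generalizing a with
  | zero =>
    simp only [pow_zero, mul_one, integral_pow, Nat.factorial_zero, Nat.cast_one, add_zero,
      Nat.factorial_succ]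
    push_cast
    have := Nat.factorial_ne_zero a
    field_simp
    simp
  | succ b ih =>
    have hderiv : ∀ x ∈ Set.uIcc 0 r, HasDerivAt (fun x : ℝ => x ^ (a + 1) * (r - x) ^ (b + 1))
        ((a + 1) * (x ^ a * (r - x) ^ (b + 1)) - (b + 1) * (x ^ (a + 1) * (r - x) ^ b)) x := by
      intro x _
      have h1 := (hasDerivAt_id x).pow (a + 1)
      have h2 := ((hasDerivAt_id x).const_sub r).pow (b + 1)
      refine (h1.mul h2).congr_deriv ?_
      simp only [id, Pi.pow_apply, Nat.cast_add, Nat.cast_one, Nat.add_sub_cancel]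
      ring
    have h := intervalIntegral.integral_eq_sub_of_hasDerivAt hderiv
      (Continuous.intervalIntegrable (by fun_prop) _ _)
    rw [intervalIntegral.integral_sub (Continuous.intervalIntegrable (by fun_prop) _ _)
      (Continuous.intervalIntegrable (by fun_prop) _ _), intervalIntegral.integral_const_mul,
      intervalIntegral.integral_const_mul, ih (a + 1)] at h
    have e : a + 1 + b + 1 = a + (b + 1) + 1 := by ring
    rw [e] at h
    simp only [sub_self, zero_pow (Nat.succ_ne_zero _), mul_zero, zero_mul] at h
    have ha : (a + 1 : ℝ) ≠ 0 := by positivity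
    apply mul_left_cancel₀ ha
    rw [sub_eq_zero.mp h, Nat.factorial_succ a, Nat.factorial_succ b]
    push_cast
    ring

theorem lintegral_indicator_pow_mul_sub_pow {r : ℝ} (hr : 0 ≤ r) (a b : ℕ) :
    ∫⁻ x : ℝ, (Set.Icc 0 r).indicator (fun x => ENNReal.ofReal (x ^ a * (r - x) ^ b)) x =
      ENNReal.ofReal
        (r ^ (a + b + 1) * ((a.factorial * b.factorial : ℝ) / ((a + b + 1).factorial : ℝ))) := by
  rw [lintegral_indicator measurableSet_Icc, ← integral_pow_mul_sub_pow_s6,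
    intervalIntegral.integral_of_le hr, ← integral_Icc_eq_integral_Ioc,
    ofReal_integral_eq_lintegral_ofReal]
  · exact Continuous.integrableOn_Icc (by fun_prop)
  · filter_upwards [ae_restrict_mem measurableSet_Icc] with x hx
    exact mul_nonneg (pow_nonneg hx.1 _) (pow_nonneg (sub_nonneg.2 hx.2) _)

theorem measurableSet_solidSimplex (t : ℕ) (r : ℝ) :
    MeasurableSet {θ : Fin t → ℝ | (∀ i, 0 ≤ θ i) ∧ ∑ i, θ i ≤ r} := by
  apply IsClosed.measurableSet
  simp only [Set.ofPred_and, Set.ofPred_forall]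
  exact (isClosed_iInter fun i => isClosed_le (by fun_prop) (by fun_prop)).inter
    (isClosed_le (by fun_prop) (by fun_prop))

/-- Dirichlet's integral over the solid simplex of size `r`. -/
theorem lintegral_solidSimplex (t m : ℕ) (α : Fin t → ℕ) {r : ℝ} (hr : 0 ≤ r) :
    ∫⁻ θ : Fin t → ℝ, {θ : Fin t → ℝ | (∀ i, 0 ≤ θ i) ∧ ∑ i, θ i ≤ r}.indicator
      (fun θ => ENNReal.ofReal ((r - ∑ i, θ i) ^ m * ∏ i, θ i ^ α i)) θ =
      ENNReal.ofReal (r ^ (m + ∑ i, α i + t) *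
        ((m.factorial * ∏ i, ((α i).factorial : ℝ)) / ((m + ∑ i, α i + t).factorial : ℝ))) := by
  induction t generalizing r with
  | zero =>
    have : (m.factorial : ℝ) ≠ 0 := by positivity
    rw [volume_pi, Measure.pi_of_empty (x := isEmptyElim), lintegral_dirac]
    simp [hr, this]
  | succ t ih =>
    have hmp := (volume_preserving_piFinSuccAbove (fun _ : Fin (t + 1) => ℝ) 0).symm
    rw [← hmp.lintegral_comp_emb (MeasurableEquiv.measurableEmbedding _), Measure.volume_eq_prod,
      lintegral_prod]
    swap
    · refine Measurable.aemeasurable ?_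
      refine Measurable.comp (Measurable.indicator (by fun_prop)
        (measurableSet_solidSimplex (t + 1) r)) (MeasurableEquiv.measurable _)
    have key : ∀ x : ℝ, (∫⁻ y : Fin t → ℝ,
        {θ : Fin (t + 1) → ℝ | (∀ i, 0 ≤ θ i) ∧ ∑ i, θ i ≤ r}.indicator
          (fun θ => ENNReal.ofReal ((r - ∑ i, θ i) ^ m * ∏ i, θ i ^ α i))
          ((MeasurableEquiv.piFinSuccAbove (fun _ : Fin (t + 1) => ℝ) 0).symm (x, y))) =
        (Set.Icc 0 r).indicator (fun x => ENNReal.ofReal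
          (x ^ α 0 * (r - x) ^ (m + ∑ i : Fin t, α i.succ + t))) x *
        ENNReal.ofReal ((m.factorial * ∏ i : Fin t, ((α i.succ).factorial : ℝ)) /
            ((m + ∑ i : Fin t, α i.succ + t).factorial : ℝ)) := by
      intro x
      by_cases hx : x ∈ Set.Icc 0 r
      · rw [Set.indicator_of_mem hx, ENNReal.ofReal_mul (pow_nonneg hx.1 _), mul_assoc,
          ← ENNReal.ofReal_mul (pow_nonneg (sub_nonneg.2 hx.2) _),
          ← ih (fun i => α i.succ) (sub_nonneg.2 hx.2), ← lintegral_const_mul]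
        · congr 1 with y
          simp only [Set.indicator, Set.mem_ofPred_eq, MeasurableEquiv.piFinSuccAbove_symm_apply,
            Fin.insertNthEquiv_apply, Fin.insertNth_zero', Fin.forall_fin_succ, Fin.cons_zero,
            Fin.cons_succ, Fin.sum_univ_succ, Fin.prod_univ_succ, hx.1, true_and, mul_ite, mul_zero]
          rw [← ENNReal.ofReal_mul (pow_nonneg hx.1 _)]
          congr 1
          · rw [le_sub_iff_add_le']
          · congr 1
            ring
        · exact Measurable.indicator (by fun_prop) (measurableSet_solidSimplex t _)
      · rw [Set.indicator_of_notMem hx, zero_mul]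
        simp only [Set.mem_Icc, not_and_or, not_le] at hx
        refine (lintegral_congr fun y => Set.indicator_of_notMem ?_ _).trans lintegral_zero
        simp only [Set.mem_ofPred_eq, MeasurableEquiv.piFinSuccAbove_symm_apply,
            Fin.insertNthEquiv_apply, Fin.insertNth_zero', Fin.forall_fin_succ, Fin.cons_zero,
            Fin.cons_succ, Fin.sum_univ_succ]
        rintro ⟨⟨h0, hy⟩, hs⟩
        have := Finset.sum_nonneg fun i (_ : i ∈ Finset.univ) => hy i
        rcases hx with hx | hx <;> linarith
    rw [lintegral_congr key, lintegral_mul_const, lintegral_indicator_pow_mul_sub_pow hr,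
      ← ENNReal.ofReal_mul (by positivity)]
    · have e : α 0 + (m + ∑ i : Fin t, α i.succ + t) + 1 = m + ∑ i, α i + (t + 1) := by
        rw [Fin.sum_univ_succ]; ring
      rw [e, Fin.prod_univ_succ]
      congr 1
      have := Nat.factorial_ne_zero (m + ∑ i : Fin t, α i.succ + t)
      have := Nat.factorial_ne_zero (m + ∑ i, α i + (t + 1))
      field_simp
    · exact Measurable.indicator (by fun_prop) measurableSet_Icc

theorem lintegral_simplexMeasure (t : ℕ) (β : Fin (t + 1) → ℕ) :
    ∫⁻ θ, ENNReal.ofReal (∏ j, θ j ^ β j) ∂simplexMeasure t =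
      ENNReal.ofReal (t.factorial * (∏ j, ((β j).factorial : ℝ)) /
        ((∑ j, β j + t).factorial : ℝ)) := by
  have hm : Measurable fun θ : Fin t → ℝ => (Fin.cons (1 - ∑ i, θ i) θ : Fin (t + 1) → ℝ) := by
    refine measurable_pi_iff.2 (Fin.cases ?_ fun i => ?_) <;> simp <;> fun_prop
  rw [simplexMeasure, lintegral_map (by fun_prop) hm, lintegral_smul_measure,
    ← lintegral_indicator (measurableSet_solidSimplex t 1)]
  have h := lintegral_solidSimplex t (β 0) (fun i => β i.succ) zero_le_one
  simp only [Fin.prod_univ_succ, Fin.cons_zero, Fin.cons_succ, Fin.sum_univ_succ]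
  rw [h, smul_eq_mul, ← ENNReal.ofReal_natCast, ← ENNReal.ofReal_mul (by positivity)]
  congr 1
  rw [one_pow]
  ring

theorem ae_simplexMeasure_nonneg (t : ℕ) : ∀ᵐ θ ∂simplexMeasure t, ∀ j, 0 ≤ θ j := by
  have hm : Measurable fun θ : Fin t → ℝ => (Fin.cons (1 - ∑ i, θ i) θ : Fin (t + 1) → ℝ) := by
    refine measurable_pi_iff.2 (Fin.cases ?_ fun i => ?_) <;> simp <;> fun_prop
  rw [simplexMeasure, ae_map_iff hm.aemeasurable]
  · refine Measure.ae_smul_measure ?_ _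
    filter_upwards [ae_restrict_mem (measurableSet_solidSimplex t 1)] with θ hθ
    simp only [Fin.forall_fin_succ, Fin.cons_zero, Fin.cons_succ, sub_nonneg]
    exact ⟨hθ.2, hθ.1⟩
  · simp only [Set.ofPred_forall]
    exact (isClosed_iInter fun i => isClosed_le (by fun_prop) (by fun_prop)).measurableSet

instance isProbabilityMeasure_simplexMeasure (t : ℕ) : IsProbabilityMeasure (simplexMeasure t) := by
  have := lintegral_simplexMeasure t 0
  have h : (t.factorial : ℝ) ≠ 0 := by positivity
  exact ⟨by simpa [h] using this⟩

theorem ae_nonneg_monomial (t : ℕ) (β : Fin (t + 1) → ℕ) :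
    0 ≤ᵐ[simplexMeasure t] fun θ => ∏ j, θ j ^ β j := by
  filter_upwards [ae_simplexMeasure_nonneg t] with θ hθ
  exact Finset.prod_nonneg fun j _ => pow_nonneg (hθ j) _

theorem integrable_monomial_simplexMeasure (t : ℕ) (β : Fin (t + 1) → ℕ) :
    Integrable (fun θ => ∏ j, θ j ^ β j) (simplexMeasure t) := by
  refine ⟨Measurable.aestronglyMeasurable (by fun_prop), ?_⟩
  rw [hasFiniteIntegral_iff_ofReal (ae_nonneg_monomial t β), lintegral_simplexMeasure]
  exact ENNReal.ofReal_lt_top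

theorem integral_monomial_simplexMeasure (t : ℕ) (β : Fin (t + 1) → ℕ) :
    ∫ θ, ∏ j, θ j ^ β j ∂simplexMeasure t =
      t.factorial * (∏ j, ((β j).factorial : ℝ)) / ((∑ j, β j + t).factorial : ℝ) := by
  rw [integral_eq_lintegral_of_nonneg_ae (ae_nonneg_monomial t β)
    (Measurable.aestronglyMeasurable (by fun_prop)), lintegral_simplexMeasure,
    ENNReal.toReal_ofReal (by positivity)]

theorem integral_monomial_simplexMeasure_one (n m : ℕ) :
    ∫ σ : Fin 2 → ℝ, ∏ j, σ j ^ (![n, m] : Fin 2 → ℕ) j ∂simplexMeasure 1 =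
      (n.factorial * m.factorial : ℝ) / ((n + m + 1).factorial : ℝ) :=
  (integral_monomial_simplexMeasure 1 ![n, m]).trans
    (by simp [Fin.prod_univ_succ, Fin.sum_univ_succ])

theorem sum_SVcol (k : ℕ) (s t : Fin k → ℕ) (v : SVState k s t) (i : Fin k) :
    ∑ j, SVcol k s t v i j = s i := by
  have h := Finset.card_eq_sum_card_fiberwise (f := v i) (s := Finset.univ) (t := Finset.univ)
    (fun _ _ => Finset.mem_coe.2 (Finset.mem_univ _))
  simpa [SVcol] using h.symm

/-- The vector `A·x`. -/
def SVstat (k : ℕ) (s t : Fin k → ℕ) (x : SVState k s t → ℕ) (i : Fin k) (j : Fin (t i + 1)) : ℕ :=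
  ∑ v, x v * SVcol k s t v i j

theorem sum_SVstat (k : ℕ) (s t : Fin k → ℕ) (x : SVState k s t → ℕ) :
    ∑ i, ∑ j, SVstat k s t x i j = (∑ v, x v) * ∑ i, s i := by
  have h (i : Fin k) : ∑ j, SVstat k s t x i j = ∑ v, x v * s i := by
    simp only [SVstat]
    rw [Finset.sum_comm]
    simp only [← Finset.mul_sum, sum_SVcol]
  simp only [h]
  rw [Finset.sum_comm, Finset.sum_mul]
  simp only [Finset.mul_sum]

theorem SVcompl_SVstat (k : ℕ) (s t : Fin k → ℕ) (U x : SVState k s t → ℕ) (hx : ∀ v, x v ≤ U v)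
    (i : Fin k) (j : Fin (t i + 1)) :
    SVcompl k s t U (fun i j => (SVstat k s t x i j : ℤ)) i j =
      (SVstat k s t (fun v => U v - x v) i j : ℤ) := by
  rw [SVcompl, sub_eq_iff_eq_add, ← Nat.cast_add, SVstat, SVstat, ← Finset.sum_add_distrib]
  congr 1
  refine Finset.sum_congr rfl fun v _ => ?_
  rw [← add_mul, Nat.sub_add_cancel (hx v)]

theorem SVstat_mem_ZAL (k : ℕ) (s t : Fin k → ℕ) (U x : SVState k s t → ℕ)
    (hx : ∀ v, x v ≤ U v) : (fun i j => (SVstat k s t x i j : ℤ)) ∈ ZAL k s t U := by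
  refine ⟨⟨fun v => x v, fun i j => ?_⟩, fun v => x v, fun v => ⟨?_, ?_⟩, fun i j => ?_⟩
  · simp [SVstat]
  · positivity
  · exact Nat.cast_le.2 (hx v)
  · simp [SVstat]

theorem finsum_ZAL_phiSV_mul (k : ℕ) (s t : Fin k → ℕ) (U : SVState k s t → ℕ)
    (G : (∀ i : Fin k, Fin (t i + 1) → ℤ) → ℝ) :
    ∑ᶠ b ∈ ZAL k s t U, (phiSV k s t U b : ℝ) * G b =
      ∑ x : ∀ v : SVState k s t, Fin (U v + 1), ((∏ v, (U v).choose (x v) : ℕ) : ℝ) *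
        G (fun i j => (SVstat k s t (fun v => x v) i j : ℤ)) := by
  classical
  let S (x : ∀ v : SVState k s t, Fin (U v + 1)) : ∀ i : Fin k, Fin (t i + 1) → ℤ :=
    fun i j => (SVstat k s t (fun v => x v) i j : ℤ)
  have hphi (b) : phiSV k s t U b =
      ∑ x : ∀ v : SVState k s t, Fin (U v + 1),
        if S x = b then ∏ v, (U v).choose (x v) else 0 := by
    simp only [phiSV, S, SVstat, funext_iff]
  rw [finsum_mem_eq_sum_of_subset (t := Finset.univ.image S)]
  · simp only [hphi, Nat.cast_sum, Finset.sum_mul]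
    rw [Finset.sum_comm]
    refine Finset.sum_congr rfl fun x _ => ?_
    simp only [Nat.cast_ite, Nat.cast_zero, ite_mul, zero_mul]
    rw [Finset.sum_ite_eq, if_pos (Finset.mem_image_of_mem _ (Finset.mem_univ x))]
  · rintro b ⟨-, hb⟩
    by_contra hmem
    refine hb ?_
    have : phiSV k s t U b = 0 := by
      rw [hphi]
      refine Finset.sum_eq_zero fun x _ => if_neg ?_
      rintro rfl
      exact hmem (by simp)
    simp [this]
  · intro b hb
    obtain ⟨x, -, rfl⟩ := Finset.mem_image.1 (Finset.mem_coe.1 hb)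
    exact SVstat_mem_ZAL k s t U _ fun v => Nat.lt_succ_iff.1 (x v).2

theorem prod_monomial_pow (k : ℕ) (s t : Fin k → ℕ) (x : SVState k s t → ℕ)
    (θ : ∀ i : Fin k, Fin (t i + 1) → ℝ) :
    ∏ v, (∏ i, ∏ j, θ i j ^ SVcol k s t v i j) ^ x v =
      ∏ i, ∏ j, θ i j ^ SVstat k s t x i j := by
  simp only [← Finset.prod_pow, ← pow_mul]
  rw [Finset.prod_comm]
  refine Finset.prod_congr rfl fun i _ => ?_
  rw [Finset.prod_comm]
  refine Finset.prod_congr rfl fun j _ => ?_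
  rw [SVstat, ← Finset.prod_pow_eq_pow_sum]
  simp only [mul_comm]

theorem prod_mixture_expand (k : ℕ) (s t : Fin k → ℕ) (U : SVState k s t → ℕ) (σ : Fin 2 → ℝ)
    (θ ρ : ∀ i : Fin k, Fin (t i + 1) → ℝ) :
    ∏ v, (σ 0 * (∏ i, ∏ j, θ i j ^ SVcol k s t v i j) +
        σ 1 * (∏ i, ∏ j, ρ i j ^ SVcol k s t v i j)) ^ U v =
      ∑ x : ∀ v : SVState k s t, Fin (U v + 1), ((∏ v, (U v).choose (x v) : ℕ) : ℝ) *
        ((∏ j, σ j ^ (![∑ v, (x v : ℕ), ∑ v, (U v - x v)] : Fin 2 → ℕ) j) *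
        ((∏ i, ∏ j, θ i j ^ SVstat k s t (fun v => x v) i j) *
         (∏ i, ∏ j, ρ i j ^ SVstat k s t (fun v => U v - x v) i j))) := by
  simp only [add_pow, Finset.sum_range]
  rw [Finset.prod_univ_sum, Fintype.piFinset_univ]
  refine Finset.sum_congr rfl fun x _ => ?_
  simp only [← prod_monomial_pow, Fin.prod_univ_two, Matrix.cons_val_zero, Matrix.cons_val_one,
    ← Finset.prod_pow_eq_pow_sum, ← Finset.prod_mul_distrib, Nat.cast_prod]
  refine Finset.prod_congr rfl fun v _ => ?_
  ring

theorem integrable_prod_monomial (k : ℕ) (t : Fin k → ℕ) (β : ∀ i : Fin k, Fin (t i + 1) → ℕ) :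
    Integrable (fun θ : ∀ i : Fin k, Fin (t i + 1) → ℝ => ∏ i, ∏ j, θ i j ^ β i j)
      (Measure.pi fun i => simplexMeasure (t i)) :=
  Integrable.fintype_prod_dep (f := fun i (θ : Fin (t i + 1) → ℝ) => ∏ j, θ j ^ β i j)
    fun i => integrable_monomial_simplexMeasure (t i) (β i)

theorem integral_prod_monomial (k : ℕ) (t : Fin k → ℕ) (β : ∀ i : Fin k, Fin (t i + 1) → ℕ) :
    ∫ θ : ∀ i : Fin k, Fin (t i + 1) → ℝ, ∏ i, ∏ j, θ i j ^ β i j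
      ∂(Measure.pi fun i => simplexMeasure (t i)) =
    ∏ i, ((t i).factorial * (∏ j, ((β i j).factorial : ℝ)) /
      ((∑ j, β i j + t i).factorial : ℝ)) := by
  rw [integral_fintype_prod_eq_prod fun i (θ : Fin (t i + 1) → ℝ) => ∏ j, θ j ^ β i j]
  simp only [integral_monomial_simplexMeasure]

theorem integral_mixture (k : ℕ) (s t : Fin k → ℕ) (U : SVState k s t → ℕ) :
    (∫ p : (Fin 2 → ℝ) ×
        ((∀ i : Fin k, Fin (t i + 1) → ℝ) × (∀ i : Fin k, Fin (t i + 1) → ℝ)),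
        ∏ v, (p.1 0 * (∏ i, ∏ j, p.2.1 i j ^ SVcol k s t v i j) +
              p.1 1 * (∏ i, ∏ j, p.2.2 i j ^ SVcol k s t v i j)) ^ U v
        ∂((simplexMeasure 1).prod
            ((Measure.pi fun i => simplexMeasure (t i)).prod
              (Measure.pi fun i => simplexMeasure (t i))))) =
      ∑ x : ∀ v : SVState k s t, Fin (U v + 1), ((∏ v, (U v).choose (x v) : ℕ) : ℝ) *
        (((∑ v, (x v : ℕ)).factorial * (∑ v, (U v - x v)).factorial : ℝ) /
            ((∑ v, U v + 1).factorial : ℝ) *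
          ((∏ i, ((t i).factorial * (∏ j, ((SVstat k s t (fun v => x v) i j).factorial : ℝ)) /
              ((∑ j, SVstat k s t (fun v => x v) i j + t i).factorial : ℝ))) *
            ∏ i, ((t i).factorial *
                (∏ j, ((SVstat k s t (fun v => U v - x v) i j).factorial : ℝ)) /
              ((∑ j, SVstat k s t (fun v => U v - x v) i j + t i).factorial : ℝ)))) := by
  simp only [prod_mixture_expand]
  rw [integral_finsetSum]
  · refine Finset.sum_congr rfl fun x _ => ?_
    have hsum : ∑ v, (x v : ℕ) + ∑ v, (U v - x v) = ∑ v, U v := by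
      rw [← Finset.sum_add_distrib]
      exact Finset.sum_congr rfl fun v _ => Nat.add_sub_cancel' (Nat.lt_succ_iff.1 (x v).2)
    rw [integral_const_mul, integral_prod_mul (L := ℝ)
      (fun σ : Fin 2 → ℝ => ∏ j, σ j ^ (![∑ v, (x v : ℕ), ∑ v, (U v - x v)] : Fin 2 → ℕ) j)
      (fun q : (∀ i : Fin k, Fin (t i + 1) → ℝ) × (∀ i : Fin k, Fin (t i + 1) → ℝ) =>
        (∏ i, ∏ j, q.1 i j ^ SVstat k s t (fun v => x v) i j) *
         (∏ i, ∏ j, q.2 i j ^ SVstat k s t (fun v => U v - x v) i j)),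
      integral_prod_mul (L := ℝ)
        (fun θ : ∀ i : Fin k, Fin (t i + 1) → ℝ =>
          ∏ i, ∏ j, θ i j ^ SVstat k s t (fun v => x v) i j)
        (fun θ : ∀ i : Fin k, Fin (t i + 1) → ℝ =>
          ∏ i, ∏ j, θ i j ^ SVstat k s t (fun v => U v - x v) i j),
      integral_prod_monomial, integral_prod_monomial, integral_monomial_simplexMeasure_one,
      hsum]
  · intro x _
    exact ((integrable_monomial_simplexMeasure 1 _).mul_prod
      ((integrable_prod_monomial k t _).mul_prod (integrable_prod_monomial k t _))).const_mul _

/-- Theorem 2 (exact formula for the marginal likelihood integral):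
`∫_Θ ∏_v (σ_0 θ^{a_v} + σ_1 ρ^{a_v})^{U_v} dσ dθ dρ` equals the sum over
`b ∈ Z_A^𝕃(U)`, `c = A·U - b`, of
`φ_A(b,U) · (|b|/a)!(|c|/a)!/(N+1)! · ∏_i [t_i! b^{(i)}_0!⋯/(|b^{(i)}|+t_i)!]
 · [t_i! c^{(i)}_0!⋯/(|c^{(i)}|+t_i)!]`;
consequently the marginal likelihood of `U` in the mixture model `M^(2)` equals
this sum times `N!/(U_1!⋯U_n!)`. -/
theorem marginal_likelihood_mixture_formula (k : ℕ) (s t : Fin k → ℕ)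
    (hk : 0 < k) (hs : ∀ i, 0 < s i) (ht : ∀ i, 0 < t i)
    (U : SVState k s t → ℕ) (N : ℕ) (hN : N = ∑ v, U v) :
    (∫ p : (Fin 2 → ℝ) ×
        ((∀ i : Fin k, Fin (t i + 1) → ℝ) × (∀ i : Fin k, Fin (t i + 1) → ℝ)),
        ∏ v, (p.1 0 * (∏ i, ∏ j, p.2.1 i j ^ SVcol k s t v i j) +
              p.1 1 * (∏ i, ∏ j, p.2.2 i j ^ SVcol k s t v i j)) ^ U v
        ∂((simplexMeasure 1).prod
            ((Measure.pi fun i => simplexMeasure (t i)).prod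
              (Measure.pi fun i => simplexMeasure (t i)))))
      = ∑ᶠ b ∈ ZAL k s t U,
          (phiSV k s t U b : ℝ)
            * ((((∑ i, ∑ j, b i j).toNat / (∑ i, s i)).factorial : ℝ) *
               (((∑ i, ∑ j, SVcompl k s t U b i j).toNat / (∑ i, s i)).factorial : ℝ) /
               ((N + 1).factorial : ℝ))
            * ∏ i,
                ((((t i).factorial : ℝ) * ∏ j, (((b i j).toNat.factorial : ℝ)))
                    / ((((∑ j, b i j).toNat + t i).factorial : ℝ)) *
                 ((((t i).factorial : ℝ) * ∏ j, (((SVcompl k s t U b i j).toNat.factorial : ℝ)))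
                    / ((((∑ j, SVcompl k s t U b i j).toNat + t i).factorial : ℝ))))
    ∧ ((N.factorial : ℝ) / ∏ v, ((U v).factorial : ℝ)) *
        (∫ p : (Fin 2 → ℝ) ×
          ((∀ i : Fin k, Fin (t i + 1) → ℝ) × (∀ i : Fin k, Fin (t i + 1) → ℝ)),
          ∏ v, (p.1 0 * (∏ i, ∏ j, p.2.1 i j ^ SVcol k s t v i j) +
                p.1 1 * (∏ i, ∏ j, p.2.2 i j ^ SVcol k s t v i j)) ^ U v
          ∂((simplexMeasure 1).prod
              ((Measure.pi fun i => simplexMeasure (t i)).prod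
                (Measure.pi fun i => simplexMeasure (t i)))))
      = ((N.factorial : ℝ) / ∏ v, ((U v).factorial : ℝ)) *
          ∑ᶠ b ∈ ZAL k s t U,
            (phiSV k s t U b : ℝ)
              * ((((∑ i, ∑ j, b i j).toNat / (∑ i, s i)).factorial : ℝ) *
                 (((∑ i, ∑ j, SVcompl k s t U b i j).toNat / (∑ i, s i)).factorial : ℝ) /
                 ((N + 1).factorial : ℝ))
              * ∏ i,
                  ((((t i).factorial : ℝ) * ∏ j, (((b i j).toNat.factorial : ℝ)))
                      / ((((∑ j, b i j).toNat + t i).factorial : ℝ)) *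
                   ((((t i).factorial : ℝ) * ∏ j, (((SVcompl k s t U b i j).toNat.factorial : ℝ)))
                      / ((((∑ j, SVcompl k s t U b i j).toNat + t i).factorial : ℝ)))) := by
  rw [and_iff_left_of_imp (fun h => by rw [h]), integral_mixture]
  have hpos : 0 < ∑ i, s i := Finset.sum_pos (fun i _ => hs i) ⟨⟨0, hk⟩, Finset.mem_univ _⟩
  simp only [mul_assoc]
  rw [finsum_ZAL_phiSV_mul]
  refine Finset.sum_congr rfl fun x _ => ?_
  have hx v : (x v : ℕ) ≤ U v := Nat.lt_succ_iff.1 (x v).2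
  simp only [SVcompl_SVstat k s t U _ hx, ← Nat.cast_sum, Int.toNat_natCast, sum_SVstat,
    Nat.mul_div_cancel _ hpos, hN, Finset.prod_mul_distrib]
end

section
/- Let A be a d×n nonnegative integer matrix with columns a_1,…,a_n (writing a_{jm} for the m-th coordinate of column a_j), let U ∈ ℕ^n, let b ∈ ℤ^d with nonnegative coordinates, and let c = A·U − b. For each j define u_j = min( {U_j} ∪ { ⌊b_m / a_{jm}⌋ : 1 ≤ m ≤ d, a_{jm} > 0 } ) and l_j = U_j − min( {U_j} ∪ { ⌊c_m / a_{jm}⌋ : 1 ≤ m ≤ d, a_{jm} > 0 } ). Then φ_A(b,U) = Σ_{x ∈ ℤ^n, A·x = b, l_j ≤ x_j ≤ u_j for all j} ∏_{v=1}^n C(U_v, x_v); that is, the defining sum for φ_A(b,U) may be restricted to the box given by the bounds l_j, u_j without changing its value. -/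
/-- `φ_A(b,U) = Σ_{x ∈ ℤ^n, 0 ≤ x_v ≤ U_v, A·x = b} ∏_v C(U_v, x_v)`. -/
def phiMat {d n : ℕ} (A : Matrix (Fin d) (Fin n) ℕ) (U : Fin n → ℕ) (b : Fin d → ℤ) : ℕ :=
  ∑ x : ∀ v : Fin n, Fin (U v + 1),
    if ∀ r, ((∑ v, (x v : ℕ) * A r v : ℕ) : ℤ) = b r then ∏ v, (U v).choose (x v : ℕ) else 0

/-- A coordinate of a bounded nonnegative solution of `A·y = b` is at most the minimum of its bound
and the quotients `⌊b_m / a_{jm}⌋`. -/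
theorem le_fold_min_div_of_mul_eq {d n : ℕ} (A : Matrix (Fin d) (Fin n) ℕ) (U y : Fin n → ℕ)
    (b : Fin d → ℤ) (hy : ∀ m, ((∑ v, y v * A m v : ℕ) : ℤ) = b m) (j : Fin n)
    (hj : y j ≤ U j) :
    y j ≤ (Finset.univ.filter fun m : Fin d => 0 < A m j).fold
      min (U j) (fun m => (b m / (A m j : ℤ)).toNat) := by
  refine (Finset.le_fold_min _).2 ⟨hj, fun m hm => ?_⟩
  have hpos : 0 < A m j := (Finset.mem_filter.1 hm).2
  have hle : y j * A m j ≤ ∑ v, y v * A m v :=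
    Finset.single_le_sum (f := fun v => y v * A m v) (fun _ _ => Nat.zero_le _)
      (Finset.mem_univ j)
  rw [← hy m, ← Int.natCast_ediv, Int.toNat_natCast]
  exact (Nat.le_div_iff_mul_le hpos).2 hle

/-- The defining sum of `φ_A(b,U)` may be restricted to the box
`l_j ≤ x_j ≤ u_j`, with `u_j = min({U_j} ∪ {⌊b_m/a_{jm}⌋ : a_{jm} > 0})` and
`l_j = U_j - min({U_j} ∪ {⌊c_m/a_{jm}⌋ : a_{jm} > 0})`, `c = A·U - b`. -/
theorem phi_box_bounds {d n : ℕ} (A : Matrix (Fin d) (Fin n) ℕ) (U : Fin n → ℕ)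
    (b : Fin d → ℤ) (hb : ∀ m, 0 ≤ b m)
    (c : Fin d → ℤ) (hc : ∀ m, c m = ((∑ v, U v * A m v : ℕ) : ℤ) - b m)
    (u l : Fin n → ℕ)
    (hu : ∀ j, u j = (Finset.univ.filter fun m : Fin d => 0 < A m j).fold
        min (U j) (fun m => (b m / (A m j : ℤ)).toNat))
    (hl : ∀ j, l j = U j - (Finset.univ.filter fun m : Fin d => 0 < A m j).fold
        min (U j) (fun m => (c m / (A m j : ℤ)).toNat)) :
    phiMat A U b
      = ∑ x : ∀ v : Fin n, Fin (U v + 1),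
          if (∀ r, ((∑ v, (x v : ℕ) * A r v : ℕ) : ℤ) = b r) ∧
             (∀ j, l j ≤ (x j : ℕ) ∧ (x j : ℕ) ≤ u j) then
            ∏ v, (U v).choose (x v : ℕ)
          else 0 := by
  unfold phiMat
  refine Finset.sum_congr rfl fun x _ => if_congr ⟨fun hx => ⟨hx, fun j => ?_⟩, And.left⟩ rfl rfl
  have hxU : ∀ v, (x v : ℕ) ≤ U v := fun v => Nat.le_of_lt_succ (x v).isLt
  have hcompl : ∀ m, ((∑ v, (U v - x v) * A m v : ℕ) : ℤ) = c m := by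
    intro m
    rw [hc m, ← hx m, eq_sub_iff_add_eq, ← Nat.cast_add, ← Finset.sum_add_distrib]
    simp only [← add_mul, Nat.sub_add_cancel (hxU _)]
  have hupper := le_fold_min_div_of_mul_eq A U (fun v => x v) b hx j (hxU j)
  have hlower := le_fold_min_div_of_mul_eq A U (fun v => U v - x v) c hcompl j (Nat.sub_le _ _)
  rw [← hu j] at hupper
  refine ⟨?_, hupper⟩
  rw [hl j]
  exact tsub_le_iff_tsub_le.1 hlower
end

section
/- Let U ∈ ℕ^n have all coordinates strictly positive. Then the dimension of the affine hull of the zonotope Z_A(U) equals the dimension of the affine hull of Z_A(1,1,…,1), which equals the rank of the matrix A, which equals d − k + 1. -/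
/-- The zonotope `Z_A(U) = {Σ_v x_v a_v : x ∈ ℝ^n, 0 ≤ x_v ≤ U_v} ⊆ ℝ^d`. -/
def SVZonotope (k : ℕ) (s t : Fin k → ℕ) (U : SVState k s t → ℕ) :
    Set (∀ i : Fin k, Fin (t i + 1) → ℝ) :=
  {y | ∃ x : SVState k s t → ℝ, (∀ v, 0 ≤ x v ∧ x v ≤ (U v : ℝ)) ∧
        y = fun i j => ∑ v, x v * (SVcol k s t v i j : ℝ)}

/-- The direction of the affine hull of the zonotope is the column space of the matrix. -/
theorem direction_affineSpan_SVZonotope (k : ℕ) (s t : Fin k → ℕ)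
    (U : SVState k s t → ℕ) (hU : ∀ v, 0 < U v) :
    (affineSpan ℝ (SVZonotope k s t U)).direction =
      Submodule.span ℝ (Set.range fun v i j => (SVcol k s t v i j : ℝ)) := by
  have h0 : (0 : ∀ i : Fin k, Fin (t i + 1) → ℝ) ∈ SVZonotope k s t U :=
    ⟨0, fun v => ⟨le_rfl, Nat.cast_nonneg _⟩, by ext i j; simp⟩
  rw [direction_affineSpan, vectorSpan_eq_span_vsub_set_right ℝ h0]
  simp only [vsub_eq_sub, sub_zero, Set.image_id']
  apply le_antisymm
  · rw [Submodule.span_le]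
    rintro y ⟨x, -, rfl⟩
    have h : (fun i j => ∑ v, x v * (SVcol k s t v i j : ℝ)) =
        ∑ v, x v • fun i j => (SVcol k s t v i j : ℝ) := by
      ext i j
      simp [Finset.sum_apply]
    rw [h]
    exact Submodule.sum_mem _ fun v _ =>
      Submodule.smul_mem _ _ (Submodule.subset_span ⟨v, rfl⟩)
  · apply Submodule.span_mono
    rintro _ ⟨v, rfl⟩
    classical
    refine ⟨Pi.single v 1, fun w => ?_, ?_⟩
    · rcases eq_or_ne w v with rfl | hw
      · simpa using Nat.one_le_iff_ne_zero.2 (hU w).ne'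
      · simp [hw]
    · ext i j
      simp [Pi.single_apply]

/-- The rank of the Segre–Veronese matrix is the dimension of the span of its columns. -/
theorem finrank_span_SVcol (k : ℕ) (s t : Fin k → ℕ) :
    Module.finrank ℝ (Submodule.span ℝ (Set.range fun (v : SVState k s t) i j =>
      (SVcol k s t v i j : ℝ))) =
    (Matrix.of fun (r : Σ i : Fin k, Fin (t i + 1)) (v : SVState k s t) =>
      (SVcol k s t v r.1 r.2 : ℝ)).rank := by
  let e := LinearEquiv.piCurry ℝ fun (i : Fin k) (_ : Fin (t i + 1)) => ℝ
  rw [Matrix.rank_eq_finrank_span_cols, ← e.finrank_map_eq, Submodule.map_span,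
    ← Set.range_comp]
  rfl

/-- A row vector applied to the column `a_v` sums its entries over the coordinates of `v`. -/
theorem SVcol_transpose_mulVec (k : ℕ) (s t : Fin k → ℕ)
    (c : (Σ i : Fin k, Fin (t i + 1)) → ℝ) (v : SVState k s t) :
    ((Matrix.of fun (r : Σ i : Fin k, Fin (t i + 1)) (v : SVState k s t) =>
      (SVcol k s t v r.1 r.2 : ℝ)).transpose.mulVec c) v = ∑ i, ∑ l, c ⟨i, v i l⟩ := by
  simp only [Matrix.mulVec, dotProduct, Matrix.transpose_apply, Matrix.of_apply,
    Fintype.sum_sigma, SVcol, Finset.card_filter, Nat.cast_sum, Finset.sum_mul]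
  refine Finset.sum_congr rfl fun i _ => ?_
  change ∑ j, ∑ l : Fin (s i), ((if v i l = j then 1 else 0 : ℕ) : ℝ) * c ⟨i, j⟩ = _
  rw [Finset.sum_comm]
  simp

/-- The left kernel of the Segre–Veronese matrix consists of the vectors that are constant on
each block, with block values orthogonal to `s`. -/
theorem ker_SVcol_transpose (k : ℕ) (s t : Fin k → ℕ) (hs : ∀ i, 0 < s i) :
    LinearMap.ker (Matrix.of fun (r : Σ i : Fin k, Fin (t i + 1)) (v : SVState k s t) =>
      (SVcol k s t v r.1 r.2 : ℝ)).transpose.mulVecLin =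
    (LinearMap.ker (Fintype.linearCombination ℝ fun i => (s i : ℝ))).map
      (LinearMap.funLeft ℝ ℝ (Sigma.fst : (Σ i : Fin k, Fin (t i + 1)) → Fin k)) := by
  ext c
  simp only [LinearMap.mem_ker, Submodule.mem_map, Matrix.mulVecLin_apply, funext_iff,
    SVcol_transpose_mulVec, Pi.zero_apply, Fintype.linearCombination_apply, smul_eq_mul,
    LinearMap.funLeft_apply]
  constructor
  · intro h
    have hconst : ∀ i j, c ⟨i, 0⟩ = c ⟨i, j⟩ := by
      intro i j
      let v : SVState k s t := fun _ _ => 0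
      let w : SVState k s t := Function.update v i (Function.update (v i) ⟨0, hs i⟩ j)
      have hd : ∑ i', ((∑ l, c ⟨i', w i' l⟩) - ∑ l, c ⟨i', v i' l⟩) = c ⟨i, j⟩ - c ⟨i, 0⟩ := by
        rw [Fintype.sum_eq_single i]
        · rw [← Finset.sum_sub_distrib, Fintype.sum_eq_single ⟨0, hs i⟩]
          · simp [w, v]
          · intro l hl
            simp [w, hl]
        · intro i' hi'
          simp [w, hi']
      rw [Finset.sum_sub_distrib, h w, h v] at hd
      linarith
    refine ⟨fun i => c ⟨i, 0⟩, ?_, fun r => hconst r.1 r.2⟩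
    simpa [mul_comm] using h fun _ _ => 0
  · rintro ⟨b, hb, hc⟩ v
    simpa [← hc, mul_comm] using hb

/-- The Segre–Veronese matrix has rank `d - k + 1`. -/
theorem rank_SVcol (k : ℕ) (s t : Fin k → ℕ) (hk : 0 < k) (hs : ∀ i, 0 < s i) :
    (Matrix.of fun (r : Σ i : Fin k, Fin (t i + 1)) (v : SVState k s t) =>
      (SVcol k s t v r.1 r.2 : ℝ)).rank = (∑ i, (t i + 1)) - k + 1 := by
  have hker := congrArg (fun S : Submodule ℝ _ => Module.finrank ℝ S) (ker_SVcol_transpose k s t hs)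
  have hinj : Function.Injective
      (LinearMap.funLeft ℝ ℝ (Sigma.fst : (Σ i : Fin k, Fin (t i + 1)) → Fin k)) :=
    LinearMap.funLeft_injective_of_surjective _ _ _ fun i => ⟨⟨i, 0⟩, rfl⟩
  have hne : Fintype.linearCombination ℝ (fun i => (s i : ℝ)) ≠ 0 := by
    intro h
    have := LinearMap.congr_fun h (Pi.single ⟨0, hk⟩ 1)
    simp [Fintype.linearCombination_apply_single, (hs _).ne'] at this
  have hdim := Module.Dual.finrank_ker_add_one_of_ne_zero hne
  rw [Module.finrank_fin_fun] at hdim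
  rw [← (Submodule.equivMapOfInjective _ hinj _).finrank_eq] at hker
  rw [← Matrix.rank_transpose]
  have hrn := LinearMap.finrank_range_add_finrank_ker
    (Matrix.of fun (r : Σ i : Fin k, Fin (t i + 1)) (v : SVState k s t) =>
      (SVcol k s t v r.1 r.2 : ℝ)).transpose.mulVecLin
  rw [hker, Module.finrank_fintype_fun_eq_card, Fintype.card_sigma] at hrn
  simp only [Fintype.card_fin] at hrn
  have hkd : k ≤ ∑ i, (t i + 1) := by simp [Finset.sum_add_distrib]
  unfold Matrix.rank
  omega

/-- For strictly positive `U`, the dimension of the zonotope `Z_A(U)` equals the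
dimension of `Z_A(1,…,1)`, which equals the rank of `A`, which equals `d - k + 1`. -/
theorem zonotope_dim (k : ℕ) (s t : Fin k → ℕ)
    (hk : 0 < k) (hs : ∀ i, 0 < s i) (ht : ∀ i, 0 < t i)
    (U : SVState k s t → ℕ) (hU : ∀ v, 0 < U v) :
    Module.finrank ℝ (affineSpan ℝ (SVZonotope k s t U)).direction
        = Module.finrank ℝ (affineSpan ℝ (SVZonotope k s t (fun _ => 1))).direction
    ∧ Module.finrank ℝ (affineSpan ℝ (SVZonotope k s t (fun _ => 1))).direction
        = (Matrix.of fun (r : Σ i : Fin k, Fin (t i + 1)) (v : SVState k s t) =>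
            (SVcol k s t v r.1 r.2 : ℝ)).rank
    ∧ (Matrix.of fun (r : Σ i : Fin k, Fin (t i + 1)) (v : SVState k s t) =>
          (SVcol k s t v r.1 r.2 : ℝ)).rank
        = (∑ i, (t i + 1)) - k + 1 := by
  rw [direction_affineSpan_SVZonotope k s t U hU,
    direction_affineSpan_SVZonotope k s t (fun _ => 1) fun _ => one_pos]
  exact ⟨rfl, finrank_span_SVcol k s t, rank_SVcol k s t hk hs⟩
end

section
/- For every data vector U ∈ ℕ^n, the Bayes factor discriminating between the independence model M and the mixture model M^(2), namely the ratio ( ∫_P θ^{A·U} dθ ) / ( ∫_Θ ∏_{v=1}^n (σ_0 θ^{a_v} + σ_1 ρ^{a_v})^{U_v} dσ dθ dρ ), is a rational number (in particular the denominator is a nonzero rational and the numerator is rational). -/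
open MeasureTheory

/-- The corner simplex `{θ ≥ 0, ∑ θ ≤ r}` in `ℝ^t`. -/
def cornerSimplex (t : ℕ) (r : ℝ) : Set (Fin t → ℝ) :=
  {θ | (∀ i, 0 ≤ θ i) ∧ ∑ i, θ i ≤ r}

theorem isCompact_cornerSimplex (t : ℕ) (r : ℝ) : IsCompact (cornerSimplex t r) := by
  refine (isCompact_Icc (a := (0 : Fin t → ℝ)) (b := fun _ => r)).of_isClosed_subset ?_ ?_
  · simp only [cornerSimplex, Set.ofPred_and, Set.ofPred_forall]
    exact (isClosed_iInter fun i => isClosed_le continuous_const (continuous_apply i)).inter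
      (isClosed_le (by fun_prop) continuous_const)
  · rintro θ ⟨h0, h1⟩
    exact ⟨h0, fun i => (Finset.single_le_sum (fun j _ => h0 j) (Finset.mem_univ i)).trans h1⟩

theorem cons_mem_cornerSimplex {t : ℕ} {r x : ℝ} {y : Fin t → ℝ} :
    (Fin.cons x y : Fin (t + 1) → ℝ) ∈ cornerSimplex (t + 1) r ↔
      x ∈ Set.Icc 0 r ∧ y ∈ cornerSimplex t (r - x) := by
  simp only [cornerSimplex, Set.mem_ofPred_eq, Fin.forall_fin_succ, Fin.cons_zero, Fin.cons_succ,
    Fin.sum_univ_succ, Set.mem_Icc]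
  constructor
  · rintro ⟨⟨hx, hy⟩, h⟩
    have := Finset.sum_nonneg fun i (_ : i ∈ Finset.univ) => hy i
    exact ⟨⟨hx, by linarith⟩, hy, by linarith⟩
  · rintro ⟨⟨hx, -⟩, hy, h⟩
    exact ⟨⟨hx, hy⟩, by linarith⟩

/-- The Euler beta integral with natural exponents is a positive rational multiple of a power of
the length of the interval. -/
theorem exists_rat_integral_pow_mul_sub_pow (a m : ℕ) :
    ∃ q : ℚ, 0 < q ∧ ∀ r : ℝ, 0 ≤ r →
      ∫ x in Set.Icc 0 r, x ^ a * (r - x) ^ m = q * r ^ (a + m + 1) := by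
  let q : ℚ := ∑ j ∈ Finset.range (m + 1), (-1) ^ (j + m) * m.choose j / (a + (m - j : ℕ) + 1)
  have key : ∀ r : ℝ, 0 ≤ r →
      ∫ x in Set.Icc 0 r, x ^ a * (r - x) ^ m = q * r ^ (a + m + 1) := by
    intro r hr
    rw [integral_Icc_eq_integral_Ioc, ← intervalIntegral.integral_of_le hr]
    simp_rw [sub_pow, Finset.mul_sum]
    rw [intervalIntegral.integral_finsetSum
      fun j _ => Continuous.intervalIntegrable (by fun_prop) _ _]
    simp only [q, Rat.cast_sum, Finset.sum_mul]
    refine Finset.sum_congr rfl fun j hj => ?_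
    have hjm : j ≤ m := Nat.lt_succ_iff.mp (Finset.mem_range.mp hj)
    have : ∀ x : ℝ, x ^ a * ((-1) ^ (j + m) * r ^ j * x ^ (m - j) * (m.choose j : ℝ)) =
        ((-1) ^ (j + m) * r ^ j * m.choose j) * x ^ (a + (m - j)) := fun x => by
      rw [pow_add x]; ring
    simp_rw [this]
    rw [intervalIntegral.integral_const_mul, integral_pow]
    have hpow : r ^ (a + m + 1) = r ^ j * r ^ (a + (m - j) + 1) := by
      rw [← pow_add]; congr 1; omega
    rw [hpow]
    push_cast
    simp only [zero_pow (Nat.succ_ne_zero _)]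
    ring
  refine ⟨q, ?_, key⟩
  have h1 := key 1 zero_le_one
  rw [integral_Icc_eq_integral_Ioc, ← intervalIntegral.integral_of_le zero_le_one, one_pow,
    mul_one] at h1
  have : (0 : ℝ) < q := by
    rw [← h1]
    refine intervalIntegral.intervalIntegral_pos_of_pos_on
      (Continuous.intervalIntegrable (by fun_prop) _ _) (fun x hx => ?_) zero_lt_one
    exact mul_pos (pow_pos hx.1 _) (pow_pos (sub_pos.2 hx.2) _)
  exact_mod_cast this

/-- The Dirichlet integral with natural exponents over the corner simplex. -/
theorem exists_rat_integral_cornerSimplex (t : ℕ) (a : Fin t → ℕ) (b : ℕ) :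
    ∃ q : ℚ, 0 < q ∧ ∀ r : ℝ, 0 ≤ r →
      ∫ θ in cornerSimplex t r, (∏ i, θ i ^ a i) * (r - ∑ i, θ i) ^ b =
        q * r ^ (∑ i, a i + b + t) := by
  induction t with
  | zero =>
    refine ⟨1, one_pos, fun r hr => ?_⟩
    have : cornerSimplex 0 r = Set.univ := by
      ext; simp [cornerSimplex, hr]
    simp [this, Measure.volume_pi_eq_dirac (0 : Fin 0 → ℝ)]
  | succ t ih =>
    obtain ⟨q, hq, hqr⟩ := ih (Fin.tail a)
    obtain ⟨p, hp, hpr⟩ := exists_rat_integral_pow_mul_sub_pow (a 0) (∑ i, Fin.tail a i + b + t)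
    refine ⟨q * p, mul_pos hq hp, fun r hr => ?_⟩
    let f : (Fin (t + 1) → ℝ) → ℝ := (cornerSimplex (t + 1) r).indicator
      fun θ => (∏ i, θ i ^ a i) * (r - ∑ i, θ i) ^ b
    have hmeas : MeasurableSet (cornerSimplex (t + 1) r) :=
      (isCompact_cornerSimplex _ _).isClosed.measurableSet
    have hf : Integrable f := by
      refine (integrable_indicator_iff hmeas).2 ?_
      exact ContinuousOn.integrableOn_compact (isCompact_cornerSimplex _ _)
        (Continuous.continuousOn (by fun_prop))
    have hpres := (volume_preserving_piFinSuccAbove (fun _ : Fin (t + 1) => ℝ) 0).symm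
    have hfc : ∀ x y, f ((MeasurableEquiv.piFinSuccAbove (fun _ => ℝ) 0).symm (x, y)) =
        (Set.Icc 0 r).indicator (fun x => x ^ a 0 * (cornerSimplex t (r - x)).indicator
          (fun y => (∏ i, y i ^ Fin.tail a i) * (r - x - ∑ i, y i) ^ b) y) x := by
      intro x y
      have : (MeasurableEquiv.piFinSuccAbove (fun _ => ℝ) 0).symm (x, y) =
        (Fin.cons x y : Fin (t + 1) → ℝ) := by
        simp [MeasurableEquiv.piFinSuccAbove, Fin.insertNthEquiv]
      rw [this]
      by_cases hx : x ∈ Set.Icc 0 r <;> by_cases hy : y ∈ cornerSimplex t (r - x) <;>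
        simp [f, Set.indicator, cons_mem_cornerSimplex, hx, hy, -Set.mem_Icc, Fin.prod_univ_succ,
          Fin.sum_univ_succ, Fin.tail, sub_sub, mul_assoc]
    rw [← integral_indicator hmeas]
    change ∫ θ, f θ = _
    rw [← hpres.integral_comp (MeasurableEquiv.measurableEmbedding _), Measure.volume_eq_prod,
      integral_prod (fun z => f ((MeasurableEquiv.piFinSuccAbove (fun _ => ℝ) 0).symm z))
      ((hpres.integrable_comp_emb (MeasurableEquiv.measurableEmbedding _)).2 hf)]
    simp_rw [hfc]
    have hinner : ∀ x, ∫ y, (Set.Icc 0 r).indicator (fun x => x ^ a 0 *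
        (cornerSimplex t (r - x)).indicator
          (fun y => (∏ i, y i ^ Fin.tail a i) * (r - x - ∑ i, y i) ^ b) y) x =
        (Set.Icc 0 r).indicator
          (fun x => q * (x ^ a 0 * (r - x) ^ (∑ i, Fin.tail a i + b + t))) x := by
      intro x
      by_cases hx : x ∈ Set.Icc 0 r
      · simp only [Set.indicator_of_mem hx]
        rw [integral_const_mul, integral_indicator
          (isCompact_cornerSimplex _ _).isClosed.measurableSet, hqr _ (sub_nonneg.2 hx.2)]
        ring
      · simp [Set.indicator_of_notMem hx]
    simp_rw [hinner]
    rw [integral_indicator measurableSet_Icc, integral_const_mul, hpr r hr, Fin.sum_univ_succ]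
    push_cast
    simp only [Fin.tail]
    ring

theorem measurable_cons_one_sub_sum (t : ℕ) :
    Measurable fun θ : Fin t → ℝ => (Fin.cons (1 - ∑ i, θ i) θ : Fin (t + 1) → ℝ) := by
  refine measurable_pi_lambda _ fun i => ?_
  refine Fin.cases ?_ (fun j => ?_) i
  · simp only [Fin.cons_zero]; fun_prop
  · simp only [Fin.cons_succ]; fun_prop

instance isFiniteMeasure_simplexMeasure (t : ℕ) : IsFiniteMeasure (simplexMeasure t) := by
  have : IsFiniteMeasure (volume.restrict (cornerSimplex t 1)) :=
    ⟨by simpa using (isCompact_cornerSimplex t 1).measure_lt_top⟩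
  have : IsFiniteMeasure ((t.factorial : ENNReal) • volume.restrict (cornerSimplex t 1)) :=
    Measure.smul_finite _ (ENNReal.natCast_ne_top _)
  exact Measure.isFiniteMeasure_map
    ((t.factorial : ENNReal) • volume.restrict (cornerSimplex t 1)) _

theorem ae_simplexMeasure_mem_Icc (t : ℕ) :
    ∀ᵐ θ ∂simplexMeasure t, ∀ j, θ j ∈ Set.Icc (0 : ℝ) 1 := by
  unfold simplexMeasure
  refine ae_map_iff (measurable_cons_one_sub_sum t).aemeasurable ?_ |>.2 ?_
  · simp only [Set.ofPred_forall]
    exact MeasurableSet.iInter fun j => measurableSet_Icc.preimage (measurable_pi_apply j)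
  refine Measure.ae_smul_measure ?_ _
  refine (ae_restrict_iff' (isCompact_cornerSimplex t 1).isClosed.measurableSet).2 (ae_of_all _ ?_)
  rintro θ ⟨h0, h1⟩
  have hs := Finset.sum_nonneg fun i (_ : i ∈ Finset.univ) => h0 i
  refine Fin.cases ?_ fun j => ?_
  · simp only [Fin.cons_zero, Set.mem_Icc]; constructor <;> linarith
  · simp only [Fin.cons_succ]
    exact ⟨h0 j, (Finset.single_le_sum (fun i _ => h0 i) (Finset.mem_univ j)).trans h1⟩

/-- `f` is integrable and its integral is a positive rational number. -/
def HasPosRatIntegral {X : Type*} [MeasurableSpace X] (μ : Measure X) (f : X → ℝ) : Prop :=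
  Integrable f μ ∧ ∃ q : ℚ, 0 < q ∧ ∫ x, f x ∂μ = q

theorem hasPosRatIntegral_simplexMeasure (t : ℕ) (a : Fin (t + 1) → ℕ) :
    HasPosRatIntegral (simplexMeasure t) fun θ => ∏ j, θ j ^ a j := by
  constructor
  · refine Integrable.of_bound (C := 1) (Continuous.aestronglyMeasurable (by fun_prop)) ?_
    filter_upwards [ae_simplexMeasure_mem_Icc t] with θ h
    rw [Real.norm_of_nonneg (Finset.prod_nonneg fun j _ => pow_nonneg (h j).1 _)]
    exact Finset.prod_le_one (fun j _ => pow_nonneg (h j).1 _)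
      fun j _ => pow_le_one₀ (h j).1 (h j).2
  · obtain ⟨q, hq, h⟩ := exists_rat_integral_cornerSimplex t (Fin.tail a) (a 0)
    refine ⟨t.factorial * q, by positivity, ?_⟩
    unfold simplexMeasure
    rw [integral_map (measurable_cons_one_sub_sum t).aemeasurable
      (Continuous.aestronglyMeasurable (by fun_prop)),
      integral_smul_measure]
    have h1 := h 1 zero_le_one
    simp only [one_pow, mul_one, Fin.tail] at h1
    simp only [Fin.prod_univ_succ, Fin.cons_zero, Fin.cons_succ]
    simp_rw [mul_comm ((1 - _) ^ _ : ℝ)]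
    change _ • ∫ θ in cornerSimplex t 1, _ = _
    rw [h1]
    simp

theorem HasPosRatIntegral.mul_prod {X Y : Type*} [MeasurableSpace X] [MeasurableSpace Y]
    {μ : Measure X} {ν : Measure Y} [SFinite μ] [SFinite ν] {f : X → ℝ} {g : Y → ℝ}
    (hf : HasPosRatIntegral μ f) (hg : HasPosRatIntegral ν g) :
    HasPosRatIntegral (μ.prod ν) fun z => f z.1 * g z.2 := by
  obtain ⟨hf, q, hq, hfq⟩ := hf
  obtain ⟨hg, p, hp, hgp⟩ := hg
  exact ⟨hf.mul_prod hg, q * p, mul_pos hq hp, by rw [integral_prod_mul, hfq, hgp]; simp⟩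

theorem HasPosRatIntegral.fintype_prod {ι : Type*} [Fintype ι] {X : ι → Type*}
    [∀ i, MeasurableSpace (X i)] {μ : ∀ i, Measure (X i)} [∀ i, SigmaFinite (μ i)]
    {f : ∀ i, X i → ℝ} (hf : ∀ i, HasPosRatIntegral (μ i) (f i)) :
    HasPosRatIntegral (Measure.pi μ) fun x => ∏ i, f i (x i) := by
  choose hi q hq h using hf
  refine ⟨Integrable.fintype_prod_dep hi, ∏ i, q i, Finset.prod_pos fun i _ => hq i, ?_⟩
  rw [integral_fintype_prod_eq_prod]
  simp [h]

/-- If all monomials in the coordinate functions `c` have rational integrals, so do all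
polynomials with rational coefficients. -/
theorem exists_rat_integral_aeval {X ι : Type*} [MeasurableSpace X] [Fintype ι] {μ : Measure X}
    {c : X → ι → ℝ} (h : ∀ a : ι → ℕ, HasPosRatIntegral μ fun x => ∏ i, c x i ^ a i)
    (P : MvPolynomial ι ℚ) :
    Integrable (fun x => MvPolynomial.aeval (c x) P) μ ∧
      ∃ q : ℚ, ∫ x, MvPolynomial.aeval (c x) P ∂μ = q := by
  induction P using MvPolynomial.induction_on' with
  | monomial a r =>
    obtain ⟨hi, q, -, hq⟩ := h a
    have : ∀ x, MvPolynomial.aeval (c x) (MvPolynomial.monomial a r) =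
        (r : ℝ) * ∏ i, c x i ^ a i := fun x => by
      rw [MvPolynomial.aeval_monomial, Finsupp.prod_fintype _ _ (by simp)]; simp
    simp_rw [this]
    exact ⟨hi.const_mul _, r * q, by rw [integral_const_mul, hq]; simp⟩
  | add p p' hp hp' =>
    obtain ⟨hi, q, hq⟩ := hp
    obtain ⟨hi', q', hq'⟩ := hp'
    simp_rw [map_add]
    exact ⟨hi.add hi', q + q', by rw [integral_add hi hi', hq, hq']; simp⟩

section SegreVeronese

variable {k : ℕ} {s t : Fin k → ℕ}

/-- The product of the Lebesgue probability measures on the simplices `Δ_{t_i}`. -/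
noncomputable abbrev simplexPi (t : Fin k → ℕ) : Measure (∀ i, Fin (t i + 1) → ℝ) :=
  Measure.pi fun i => simplexMeasure (t i)

theorem hasPosRatIntegral_simplexPi (a : ∀ i, Fin (t i + 1) → ℕ) :
    HasPosRatIntegral (simplexPi t) fun θ => ∏ i, ∏ j, θ i j ^ a i j :=
  HasPosRatIntegral.fintype_prod fun i => hasPosRatIntegral_simplexMeasure (t i) (a i)

/-- The parameter space of the mixture model, as a product of coordinate spaces. -/
abbrev MixtureParam (t : Fin k → ℕ) :=
  (Fin 2 → ℝ) × ((∀ i : Fin k, Fin (t i + 1) → ℝ) × (∀ i : Fin k, Fin (t i + 1) → ℝ))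

/-- The product Lebesgue probability measure on `Δ_1 × P × P`. -/
noncomputable abbrev mixtureMeasure (t : Fin k → ℕ) : Measure (MixtureParam t) :=
  (simplexMeasure 1).prod ((simplexPi t).prod (simplexPi t))

/-- The index type of the coordinates of the mixture model. -/
abbrev MixtureIndex (t : Fin k → ℕ) :=
  Fin 2 ⊕ ((Σ i, Fin (t i + 1)) ⊕ (Σ i, Fin (t i + 1)))

/-- The coordinates of a parameter of the mixture model. -/
def mixtureCoord (p : MixtureParam t) : MixtureIndex t → ℝ :=
  Sum.elim p.1 (Sum.elim (fun z => p.2.1 z.1 z.2) fun z => p.2.2 z.1 z.2)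

theorem hasPosRatIntegral_mixtureMeasure (a : MixtureIndex t → ℕ) :
    HasPosRatIntegral (mixtureMeasure t) fun p => ∏ z, mixtureCoord p z ^ a z := by
  have := (hasPosRatIntegral_simplexMeasure 1 fun j => a (.inl j)).mul_prod
    ((hasPosRatIntegral_simplexPi (t := t) fun i j => a (.inr (.inl ⟨i, j⟩))).mul_prod
      (hasPosRatIntegral_simplexPi fun i j => a (.inr (.inr ⟨i, j⟩))))
  simpa only [Fintype.prod_sum_type, Fintype.prod_sigma, mixtureCoord, Sum.elim_inl,
    Sum.elim_inr] using this

theorem ae_mixtureMeasure_nonneg (t : Fin k → ℕ) :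
    ∀ᵐ p ∂mixtureMeasure t, (∀ j, 0 ≤ p.1 j) ∧ (∀ i j, 0 ≤ p.2.1 i j) ∧ ∀ i j, 0 ≤ p.2.2 i j := by
  have hpi : ∀ᵐ θ ∂simplexPi t, ∀ i j, 0 ≤ θ i j := by
    refine ae_all_iff.2 fun i => ?_
    filter_upwards [(Measure.quasiMeasurePreserving_eval
      (μ := fun i => simplexMeasure (t i)) i).ae (ae_simplexMeasure_mem_Icc (t i))] with θ h j
    exact (h j).1
  filter_upwards [Measure.quasiMeasurePreserving_fst.ae (ae_simplexMeasure_mem_Icc 1),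
    Measure.quasiMeasurePreserving_snd.ae (Measure.quasiMeasurePreserving_fst.ae hpi),
    Measure.quasiMeasurePreserving_snd.ae (Measure.quasiMeasurePreserving_snd.ae hpi)]
    with p h h' h''
  exact ⟨fun j => (h j).1, h', h''⟩

/-- The mixture likelihood. -/
noncomputable def mixtureLikelihood (U : SVState k s t → ℕ) (p : MixtureParam t) : ℝ :=
  ∏ v, (p.1 0 * (∏ i, ∏ j, p.2.1 i j ^ SVcol k s t v i j) +
    p.1 1 * (∏ i, ∏ j, p.2.2 i j ^ SVcol k s t v i j)) ^ U v

/-- The mixture likelihood as a polynomial in the coordinates. -/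
noncomputable def mixturePolynomial (U : SVState k s t → ℕ) : MvPolynomial (MixtureIndex t) ℚ :=
  ∏ v, (.X (.inl 0) * (∏ i, ∏ j, .X (.inr (.inl ⟨i, j⟩)) ^ SVcol k s t v i j) +
    .X (.inl 1) * (∏ i, ∏ j, .X (.inr (.inr ⟨i, j⟩)) ^ SVcol k s t v i j)) ^ U v

theorem aeval_mixturePolynomial (U : SVState k s t → ℕ) (p : MixtureParam t) :
    MvPolynomial.aeval (mixtureCoord p) (mixturePolynomial U) = mixtureLikelihood U p := by
  simp [mixturePolynomial, mixtureLikelihood, mixtureCoord]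

theorem prod_mul_monomial_pow (U : SVState k s t → ℕ) (x : ℝ) (θ : ∀ i, Fin (t i + 1) → ℝ) :
    ∏ v, (x * ∏ i, ∏ j, θ i j ^ SVcol k s t v i j) ^ U v =
      x ^ (∑ v, U v) * ∏ i, ∏ j, θ i j ^ (∑ v, U v * SVcol k s t v i j) := by
  simp_rw [mul_pow, Finset.prod_mul_distrib, Finset.prod_pow_eq_pow_sum, ← Finset.prod_pow,
    ← pow_mul]
  congr 1
  rw [Finset.prod_comm]
  refine Finset.prod_congr rfl fun i _ => ?_
  rw [Finset.prod_comm]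
  refine Finset.prod_congr rfl fun j _ => ?_
  rw [Finset.prod_pow_eq_pow_sum]
  simp_rw [mul_comm]

theorem hasPosRatIntegral_mixtureLikelihood (U : SVState k s t → ℕ) :
    HasPosRatIntegral (mixtureMeasure t) (mixtureLikelihood U) := by
  obtain ⟨hi, q, hq⟩ :=
    exists_rat_integral_aeval hasPosRatIntegral_mixtureMeasure (mixturePolynomial U)
  simp_rw [aeval_mixturePolynomial] at hi hq
  refine ⟨hi, q, ?_, hq⟩
  let a : MixtureIndex t → ℕ := Sum.elim ![∑ v, U v, 0]
    (Sum.elim (fun z => ∑ v, U v * SVcol k s t v z.1 z.2) 0)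
  obtain ⟨hi', q', hpos, hq'⟩ := hasPosRatIntegral_mixtureMeasure a
  have hle : ∫ p, ∏ z, mixtureCoord p z ^ a z ∂mixtureMeasure t ≤
      ∫ p, mixtureLikelihood U p ∂mixtureMeasure t := by
    refine integral_mono_ae hi' hi ?_
    filter_upwards [ae_mixtureMeasure_nonneg t] with p ⟨h0, h1, h2⟩
    have hp : ∏ z, mixtureCoord p z ^ a z =
        ∏ v, (p.1 0 * ∏ i, ∏ j, p.2.1 i j ^ SVcol k s t v i j) ^ U v := by
      rw [prod_mul_monomial_pow]
      simp [a, mixtureCoord, Fintype.prod_sum_type, Fintype.prod_sigma]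
    have hmon : ∀ θ : ∀ i, Fin (t i + 1) → ℝ, (∀ i j, 0 ≤ θ i j) → ∀ v,
        0 ≤ ∏ i, ∏ j, θ i j ^ SVcol k s t v i j := fun θ hθ v =>
      Finset.prod_nonneg fun i _ => Finset.prod_nonneg fun j _ => pow_nonneg (hθ i j) _
    rw [hp]
    refine Finset.prod_le_prod
      (fun v _ => pow_nonneg (mul_nonneg (h0 0) (hmon _ h1 v)) _) fun v _ => ?_
    exact pow_le_pow_left₀ (mul_nonneg (h0 0) (hmon _ h1 v))
      (le_add_of_nonneg_right (mul_nonneg (h0 1) (hmon _ h2 v))) _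
  rw [hq', hq] at hle
  exact hpos.trans_le (by exact_mod_cast hle)

end SegreVeronese

/-- The Bayes factor discriminating between the independence model `M` and the mixture
model `M^(2)`, namely `(∫_P θ^{A·U} dθ) / (∫_Θ ∏_v (σ_0θ^{a_v}+σ_1ρ^{a_v})^{U_v})`,
is a rational number: the numerator is rational and the denominator is a nonzero
rational. -/
theorem bayes_factor_rational (k : ℕ) (s t : Fin k → ℕ)
    (hk : 0 < k) (hs : ∀ i, 0 < s i) (ht : ∀ i, 0 < t i)
    (U : SVState k s t → ℕ) :
    ∃ qnum qden : ℚ, qden ≠ 0 ∧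
      (∫ θ : ∀ i : Fin k, Fin (t i + 1) → ℝ,
          (∏ i, ∏ j, θ i j ^ (∑ v, U v * SVcol k s t v i j))
          ∂(Measure.pi fun i => simplexMeasure (t i))) = (qnum : ℝ) ∧
      (∫ p : (Fin 2 → ℝ) ×
          ((∀ i : Fin k, Fin (t i + 1) → ℝ) × (∀ i : Fin k, Fin (t i + 1) → ℝ)),
          ∏ v, (p.1 0 * (∏ i, ∏ j, p.2.1 i j ^ SVcol k s t v i j) +
                p.1 1 * (∏ i, ∏ j, p.2.2 i j ^ SVcol k s t v i j)) ^ U v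
          ∂((simplexMeasure 1).prod
              ((Measure.pi fun i => simplexMeasure (t i)).prod
                (Measure.pi fun i => simplexMeasure (t i))))) = (qden : ℝ) ∧
      (∫ θ : ∀ i : Fin k, Fin (t i + 1) → ℝ,
          (∏ i, ∏ j, θ i j ^ (∑ v, U v * SVcol k s t v i j))
          ∂(Measure.pi fun i => simplexMeasure (t i))) /
        (∫ p : (Fin 2 → ℝ) ×
            ((∀ i : Fin k, Fin (t i + 1) → ℝ) × (∀ i : Fin k, Fin (t i + 1) → ℝ)),
            ∏ v, (p.1 0 * (∏ i, ∏ j, p.2.1 i j ^ SVcol k s t v i j) +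
                  p.1 1 * (∏ i, ∏ j, p.2.2 i j ^ SVcol k s t v i j)) ^ U v
            ∂((simplexMeasure 1).prod
                ((Measure.pi fun i => simplexMeasure (t i)).prod
                  (Measure.pi fun i => simplexMeasure (t i)))))
        = ((qnum / qden : ℚ) : ℝ) := by
  obtain ⟨-, qnum, -, hnum⟩ :=
    hasPosRatIntegral_simplexPi (t := t) fun i j => ∑ v, U v * SVcol k s t v i j
  obtain ⟨-, qden, hpos, hden⟩ := hasPosRatIntegral_mixtureLikelihood U
  simp only [mixtureLikelihood] at hden
  refine ⟨qnum, qden, hpos.ne', hnum, hden, ?_⟩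
  rw [hnum, hden, Rat.cast_div]
end
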